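/- Let 0 < p ≤ 1, let ω be a weight on ℤ, let A be a unital Banach algebra, and let f : 𝕋 → A be continuous with pω-ACFS. If f(z) is left invertible in A for every z ∈ 𝕋, then there exist a weight ν on ℤ and a continuous function g : 𝕋 → A such that: (1) 1 ≤ ν(n) ≤ ω(n) for all n ∈ ℤ; (2) ν is constant if and only if ω is constant; (3) g has pν-ACFS; (4) g(z)·f(z) equals the unit of A for all z ∈ 𝕋. In particular, if ω is admissible, then f has a left inverse with pω-ACFS. -/

import Mathlib

open scoped BigOperators

/-- A weight on `ℤ`: `ω : ℤ → [1,∞)` with `ω(m+n) ≤ ω(m)ω(n)`. -/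
def IsWeight (ω : ℤ → ℝ) : Prop :=
  (∀ n, 1 ≤ ω n) ∧ ∀ m n, ω (m + n) ≤ ω m * ω n

/-- `ρ₁(ω) = sup{ω(-n)^{-1/n} : n ∈ ℕ, n ≥ 1}`. -/
noncomputable def rho1 (ω : ℤ → ℝ) : ℝ :=
  sSup {x : ℝ | ∃ n : ℕ, 0 < n ∧ x = ω (-(n : ℤ)) ^ (-(1 : ℝ) / (n : ℝ))}

/-- `ρ₂(ω) = inf{ω(n)^{1/n} : n ∈ ℕ, n ≥ 1}`. -/
noncomputable def rho2 (ω : ℤ → ℝ) : ℝ :=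
  sInf {x : ℝ | ∃ n : ℕ, 0 < n ∧ x = ω (n : ℤ) ^ ((1 : ℝ) / (n : ℝ))}

/-- A weight is admissible if `ρ₁(ω) = ρ₂(ω) = 1`. -/
def IsAdmissible (ω : ℤ → ℝ) : Prop := rho1 ω = 1 ∧ rho2 ω = 1

/-- The `n`-th Fourier coefficient of `f : 𝕋 → A`,
`f̂(n) = (1/2π) ∫₀^{2π} f(e^{it}) e^{-int} dt`. -/
noncomputable def fourierCoef {A : Type*} [NormedRing A] [NormedAlgebra ℂ A]
    (f : ℂ → A) (n : ℤ) : A :=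
  ((2 * Real.pi : ℝ) : ℂ)⁻¹ • ∫ t in (0 : ℝ)..(2 * Real.pi),
    Complex.exp (-(n : ℂ) * Complex.I * (t : ℂ)) • f (Complex.exp (Complex.I * (t : ℂ)))

/-- `f` has `p`-th power `ω`-absolutely convergent Fourier series:
`f(z) = ∑_{n∈ℤ} f̂(n) zⁿ` on the circle and `∑_{n∈ℤ} ‖f̂(n)‖^p ω(n)^p < ∞`. -/
def HasPACFS {A : Type*} [NormedRing A] [NormedAlgebra ℂ A] [CompleteSpace A]
    (p : ℝ) (ω : ℤ → ℝ) (f : ℂ → A) : Prop :=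
  (∀ z : ℂ, ‖z‖ = 1 → HasSum (fun n : ℤ => z ^ n • fourierCoef f n) (f z)) ∧
  Summable fun n : ℤ => ‖fourierCoef f n‖ ^ p * ω n ^ p


section GM

lemma norm_pow_sub_pow_le_aux (a b : ℂ) (δ : ℝ) (ha : ‖a‖ ≤ δ) (hb : ‖b‖ ≤ δ) (m : ℕ) :
    ‖a ^ m - b ^ m‖ ≤ ‖a - b‖ * (m * δ ^ (m - 1)) := by
  have hδ : 0 ≤ δ := (norm_nonneg a).trans ha
  rw [← (Commute.all a b).mul_geom_sum₂ m, norm_mul]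
  gcongr
  refine (norm_sum_le _ _).trans ?_
  have : ∀ i ∈ Finset.range m, ‖a ^ i * b ^ (m - 1 - i)‖ ≤ δ ^ (m - 1) := by
    intro i hi
    have hi' : i < m := Finset.mem_range.1 hi
    rw [norm_mul, norm_pow, norm_pow]
    calc ‖a‖ ^ i * ‖b‖ ^ (m - 1 - i) ≤ δ ^ i * δ ^ (m - 1 - i) := by gcongr
      _ = δ ^ (m - 1) := by rw [← pow_add]; congr 1; omega
  refine (Finset.sum_le_sum this).trans ?_
  simp

variable {B : Type*} [NormedRing B] [CompleteSpace B] [Algebra ℂ B]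

lemma local_res (p K : ℝ) (hp : 0 < p) (hK : 0 ≤ K)
    (hs : ∀ (c : ℂ) (x : B), ‖c • x‖ ≤ K * ‖c‖ ^ p * ‖x‖) (q : B) (lam : ℂ) :
    ∃ δ > 0, (∀ μ ∈ Metric.ball lam δ, Summable (fun m : ℕ => (μ - lam) ^ m • q ^ (m + 1))) ∧
      ∃ C : ℝ, 0 ≤ C ∧ ∀ (s : Finset ℕ) (c μ μ' : ℕ → ℂ) (η : ℝ), 0 ≤ η →
        ∑ i ∈ s, ‖c i‖ ≤ 1 → (∀ i ∈ s, μ i ∈ Metric.ball lam δ) →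
        (∀ i ∈ s, μ' i ∈ Metric.ball lam δ) → (∀ i ∈ s, ‖μ i - μ' i‖ ≤ η) →
        ‖∑ i ∈ s, c i • ((∑' m : ℕ, (μ i - lam) ^ m • q ^ (m + 1)) -
          ∑' m : ℕ, (μ' i - lam) ^ m • q ^ (m + 1))‖ ≤ C * η ^ p := by
  set Q := ‖q‖ with hQ
  have hQ0 : 0 ≤ Q := norm_nonneg q
  set δ : ℝ := ((Q + 1)⁻¹) ^ (p⁻¹) / 2 with hδ
  have hδ0 : 0 < δ := by positivity
  set t : ℝ := (2 * δ) ^ p with ht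
  have ht0 : 0 ≤ t := by positivity
  have ht1 : t = (Q + 1)⁻¹ := by
    rw [ht, hδ, mul_div_cancel₀ _ (two_ne_zero), Real.rpow_inv_rpow (by positivity) hp.ne']
  have htQ : t * Q < 1 := by
    rw [ht1, inv_mul_lt_iff₀ (by positivity)]; linarith
  have hgeo : Summable (fun m : ℕ => (t * Q) ^ m) :=
    summable_geometric_of_lt_one (by positivity) htQ
  have hqn : ∀ m : ℕ, ‖q ^ (m + 1)‖ ≤ Q ^ (m + 1) := fun m => norm_pow_le' q (Nat.succ_pos m)
  have hpow : ∀ (m : ℕ), ((2 * δ) ^ m) ^ p = t ^ m := by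
    intro m
    rw [ht, ← Real.rpow_natCast, ← Real.rpow_natCast, ← Real.rpow_mul (by positivity),
      ← Real.rpow_mul (by positivity), mul_comm (m : ℝ) p]
  have hsum : ∀ μ ∈ Metric.ball lam δ, Summable (fun m : ℕ => (μ - lam) ^ m • q ^ (m + 1)) := by
    intro μ hμ
    have hμ' : ‖μ - lam‖ ≤ 2 * δ := by
      have := mem_ball_iff_norm.1 hμ
      linarith
    refine Summable.of_norm_bounded (g := fun m => K * Q * (t * Q) ^ m) (hgeo.mul_left _) ?_
    intro m
    calc _ ≤ K * ‖(μ - lam) ^ m‖ ^ p * ‖q ^ (m + 1)‖ := hs _ _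
      _ ≤ K * ((2 * δ) ^ m) ^ p * Q ^ (m + 1) := by
        rw [norm_pow]
        gcongr
        exact hqn m
      _ = _ := by rw [hpow]; ring
  set u : ℕ → ℝ := fun m => K * (m * δ ^ (m - 1)) ^ p * ‖q ^ (m + 1)‖ with hu
  have hu0 : ∀ m, 0 ≤ u m := fun m => by positivity
  have husum : Summable u := by
    rw [← summable_nat_add_iff 1]
    refine Summable.of_nonneg_of_le (fun m => hu0 _) (f := fun m => K * Q ^ 2 * (t * Q) ^ m) ?_
      (hgeo.mul_left _)
    intro m
    have h1 : ((m + 1 : ℕ) : ℝ) * δ ^ (m + 1 - 1) ≤ (2 * δ) ^ m := by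
      rw [mul_pow, Nat.add_sub_cancel]
      gcongr
      have : m + 1 ≤ 2 ^ m := Nat.lt_two_pow_self
      exact_mod_cast this
    calc u (m + 1) ≤ K * ((2 * δ) ^ m) ^ p * Q ^ (m + 1 + 1) := by
          simp only [hu]
          gcongr
          exact hqn _
      _ = _ := by rw [hpow]; ring
  refine ⟨δ, hδ0, hsum, ∑' m, u m, tsum_nonneg hu0, ?_⟩
  intro s c μ μ' η hη hc hμ hμ' hμμ
  have key : HasSum (fun m : ℕ => (∑ i ∈ s, c i * ((μ i - lam) ^ m - (μ' i - lam) ^ m)) • q ^ (m + 1))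
      (∑ i ∈ s, c i • ((∑' m : ℕ, (μ i - lam) ^ m • q ^ (m + 1)) -
          ∑' m : ℕ, (μ' i - lam) ^ m • q ^ (m + 1))) := by
    have : ∀ i ∈ s, HasSum (fun m : ℕ => (c i * ((μ i - lam) ^ m - (μ' i - lam) ^ m)) • q ^ (m + 1))
        (c i • ((∑' m : ℕ, (μ i - lam) ^ m • q ^ (m + 1)) -
          ∑' m : ℕ, (μ' i - lam) ^ m • q ^ (m + 1))) := by
      intro i hi
      have := ((hsum _ (hμ i hi)).hasSum.sub (hsum _ (hμ' i hi)).hasSum).mul_left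
        (algebraMap ℂ B (c i))
      simpa only [← Algebra.smul_def, ← sub_smul, smul_smul] using this
    have := hasSum_sum this
    simpa only [← Finset.sum_smul] using this
  have hb : ∀ m : ℕ, ‖(∑ i ∈ s, c i * ((μ i - lam) ^ m - (μ' i - lam) ^ m)) • q ^ (m + 1)‖
      ≤ u m * η ^ p := by
    intro m
    refine (hs _ _).trans ?_
    have h2 : ‖∑ i ∈ s, c i * ((μ i - lam) ^ m - (μ' i - lam) ^ m)‖ ≤ η * (m * δ ^ (m - 1)) := by
      refine (norm_sum_le _ _).trans ?_
      calc _ ≤ ∑ i ∈ s, ‖c i‖ * (η * (m * δ ^ (m - 1))) := by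
            refine Finset.sum_le_sum fun i hi => ?_
            rw [norm_mul]
            gcongr
            refine (norm_pow_sub_pow_le_aux _ _ δ (mem_ball_iff_norm.1 (hμ i hi)).le
              (mem_ball_iff_norm.1 (hμ' i hi)).le m).trans ?_
            rw [sub_sub_sub_cancel_right]
            gcongr
            exact hμμ i hi
        _ = (∑ i ∈ s, ‖c i‖) * (η * (m * δ ^ (m - 1))) := by rw [Finset.sum_mul]
        _ ≤ 1 * (η * (m * δ ^ (m - 1))) := by gcongr
        _ = _ := one_mul _
    calc _ ≤ K * (η * (m * δ ^ (m - 1))) ^ p * ‖q ^ (m + 1)‖ := by gcongr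
      _ = u m * η ^ p := by
        rw [Real.mul_rpow hη (by positivity)]; simp only [hu]; ring
  rw [← key.tsum_eq, ← tsum_mul_right]
  exact tsum_of_norm_bounded (husum.mul_right _).hasSum hb

/-- Sum over roots of unity. -/
lemma roots_sum (n : ℕ) (hn : 0 < n) (ζ : ℂ) (hζ : IsPrimitiveRoot ζ n) (r : ℂ) (z : B) :
    ∑ l ∈ Finset.range n, ((n : ℂ)⁻¹ * ζ ^ l) •
      ∑ i ∈ Finset.range n, ((r * ζ ^ l) ^ (n - 1 - i)) • z ^ i = algebraMap ℂ B (r ^ (n - 1)) := by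
  have hn' : (n : ℂ) ≠ 0 := by exact_mod_cast hn.ne'
  simp_rw [Finset.smul_sum, smul_smul]
  rw [Finset.sum_comm]
  simp_rw [← Finset.sum_smul]
  have h : ∀ i ∈ Finset.range n, ∑ l ∈ Finset.range n,
      ((n : ℂ)⁻¹ * ζ ^ l * (r * ζ ^ l) ^ (n - 1 - i)) = if i = 0 then r ^ (n - 1) else 0 := by
    intro i hi
    have hi' := Finset.mem_range.1 hi
    have e : ∀ l ∈ Finset.range n, (n : ℂ)⁻¹ * ζ ^ l * (r * ζ ^ l) ^ (n - 1 - i)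
        = (n : ℂ)⁻¹ * r ^ (n - 1 - i) * (ζ ^ (n - i)) ^ l := by
      intro l _
      have : n - i = (n - 1 - i) + 1 := by omega
      rw [this]; ring
    rw [Finset.sum_congr rfl e, ← Finset.mul_sum]
    split_ifs with h0
    · subst h0
      simp [hζ.pow_eq_one]
      field_simp
    · have hne : ζ ^ (n - i) ≠ 1 := hζ.pow_ne_one_of_pos_of_lt (by omega) (by omega)
      rw [geom_sum_eq hne, ← pow_mul, mul_comm (n - i), pow_mul, hζ.pow_eq_one]
      simp
  rw [Finset.sum_congr rfl (fun i hi => by rw [h i hi])]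
  simp only [ite_smul, zero_smul]
  rw [Finset.sum_ite_eq' , if_pos (Finset.mem_range.2 hn), pow_zero, Algebra.algebraMap_eq_smul_one]


lemma res_mem (M : Ideal B) (hM : M.IsMaximal) (z : B) (hzc : ∀ x, z * x = x * z)
    (p K : ℝ) (hp : 0 < p) (hK : 0 ≤ K)
    (hs : ∀ (c : ℂ) (x : B), ‖c • x‖ ≤ K * ‖c‖ ^ p * ‖x‖) (lam : ℂ)
    (hlam : z - algebraMap ℂ B lam ∉ M) :
    ∃ δ > 0, ∃ S : ℂ → B, (∀ μ ∈ Metric.ball lam δ, (z - algebraMap ℂ B μ) * S μ - 1 ∈ M) ∧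
      ∃ C : ℝ, 0 ≤ C ∧ ∀ (s : Finset ℕ) (c μ μ' : ℕ → ℂ) (η : ℝ), 0 ≤ η →
        ∑ i ∈ s, ‖c i‖ ≤ 1 → (∀ i ∈ s, μ i ∈ Metric.ball lam δ) →
        (∀ i ∈ s, μ' i ∈ Metric.ball lam δ) → (∀ i ∈ s, ‖μ i - μ' i‖ ≤ η) →
        ‖∑ i ∈ s, c i • (S (μ i) - S (μ' i))‖ ≤ C * η ^ p := by
  have hcl : IsClosed (M : Set B) := by
    refine isClosed_of_closure_subset (Eq.subset ?_)
    exact congr_arg ((↑) : Ideal B → Set B) hM.closure_eq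
  obtain ⟨x, hx⟩ : ∃ x, x = z - algebraMap ℂ B lam := ⟨_, rfl⟩
  rw [← hx] at hlam
  have hxc : ∀ y, x * y = y * x := by
    intro y
    rw [hx, sub_mul, mul_sub, hzc, Algebra.commutes]
  have hsm : ∀ (c : ℂ) (m : B), m ∈ M → c • m ∈ M := by
    intro c m hm
    rw [Algebra.smul_def]; exact M.mul_mem_left _ hm
  obtain ⟨q, hq⟩ : ∃ q, x * q - 1 ∈ M := by
    have h1 : M ⊔ Ideal.span {x} = ⊤ := by
      refine hM.out.2 _ (lt_of_le_of_ne le_sup_left ?_)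
      intro h
      apply hlam
      rw [h]
      exact (le_sup_right : Ideal.span {x} ≤ _) (Ideal.mem_span_singleton_self x)
    have h2 : (1 : B) ∈ M ⊔ Ideal.span {x} := by rw [h1]; trivial
    obtain ⟨m, hm, y, hy, hmy⟩ := Submodule.mem_sup.1 h2
    obtain ⟨q, rfl⟩ := Ideal.mem_span_singleton'.1 hy
    refine ⟨q, ?_⟩
    rw [hxc, ← hmy]
    simpa using M.neg_mem hm
  have hinj : ∀ y, x * y ∈ M → y ∈ M := by
    let I : Ideal B := Submodule.comap (LinearMap.toSpanSingleton B B x) M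
    have hI : ∀ y, y ∈ I ↔ y * x ∈ M := by
      intro y
      simp [I]
    have : M = I := by
      refine hM.eq_of_le ?_ ?_
      · rw [Ne, Ideal.eq_top_iff_one, hI, one_mul]
        exact hlam
      · intro y hy
        rw [hI, ← hxc]
        exact M.mul_mem_left _ hy
    intro y hy
    rw [this, hI, ← hxc]
    exact hy
  have hMq : ∀ m ∈ M, m * q ∈ M := by
    intro m hm
    apply hinj
    have : x * (m * q) = m * (x * q - 1) + m := by
      rw [← mul_assoc, hxc m, mul_sub m (x * q), mul_one, mul_assoc]; abel
    rw [this]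
    exact M.add_mem (M.mul_mem_left _ hq) hm
  have hMqn : ∀ (n : ℕ), ∀ m ∈ M, m * q ^ n ∈ M := by
    intro n
    induction n with
    | zero => intro m hm; simpa using hm
    | succ n ih => intro m hm; rw [pow_succ, ← mul_assoc]; exact hMq _ (ih m hm)
  obtain ⟨δ, hδ, hsum, C, hC, hbd⟩ := local_res p K hp hK hs q lam
  refine ⟨δ, hδ, fun μ => ∑' m : ℕ, (μ - lam) ^ m • q ^ (m + 1), ?_, C, hC, hbd⟩
  intro μ hμ
  have hS := hsum μ hμ
  have hT := hS.hasSum.tendsto_sum_nat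
  have h0 := hS.tendsto_atTop_zero
  have hind : ∀ N : ℕ, (z - algebraMap ℂ B μ) *
      (∑ m ∈ Finset.range N, (μ - lam) ^ m • q ^ (m + 1)) - 1 + (μ - lam) ^ N • q ^ N ∈ M := by
    intro N
    induction N with
    | zero => simp
    | succ N ih =>
      rw [Finset.sum_range_succ]
      have e : (z - algebraMap ℂ B μ) * (∑ m ∈ Finset.range N, (μ - lam) ^ m • q ^ (m + 1) +
          (μ - lam) ^ N • q ^ (N + 1)) - 1 + (μ - lam) ^ (N + 1) • q ^ (N + 1)
          = ((z - algebraMap ℂ B μ) *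
            (∑ m ∈ Finset.range N, (μ - lam) ^ m • q ^ (m + 1)) - 1 + (μ - lam) ^ N • q ^ N)
            + (μ - lam) ^ N • ((x * q - 1) * q ^ N) := by
        have e1 : z - algebraMap ℂ B μ = x - algebraMap ℂ B (μ - lam) := by
          rw [hx, map_sub]; abel
        rw [mul_add, sub_mul (x * q) 1, one_mul, mul_assoc x, ← pow_succ', smul_sub,
          pow_succ (μ - lam) N, mul_comm _ (μ - lam), mul_smul]
        have e2 : (z - algebraMap ℂ B μ) * (μ - lam) ^ N • q ^ (N + 1)
          = (μ - lam) ^ N • (x * q ^ (N + 1)) - (μ - lam) • (μ - lam) ^ N • q ^ (N + 1) := by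
          rw [e1, sub_mul, mul_smul_comm, ← Algebra.smul_def]
        rw [e2]; abel
      rw [e]
      exact M.add_mem ih (hsm _ _ (hMqn _ _ hq))
  have hlim : Filter.Tendsto (fun N : ℕ => (z - algebraMap ℂ B μ) *
      (∑ m ∈ Finset.range (N + 1), (μ - lam) ^ m • q ^ (m + 1)) - 1 +
        (μ - lam) ^ (N + 1) • q ^ (N + 1)) Filter.atTop
      (nhds ((z - algebraMap ℂ B μ) * (∑' m : ℕ, (μ - lam) ^ m • q ^ (m + 1)) - 1 + 0)) := by
    refine Filter.Tendsto.add ((((Filter.tendsto_add_atTop_iff_nat 1).2 hT).const_mul _).sub_const _) ?_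
    have := h0.const_mul (algebraMap ℂ B (μ - lam))
    rw [mul_zero] at this
    refine this.congr fun N => ?_
    rw [← Algebra.smul_def, smul_smul, pow_succ' (μ - lam)]
  rw [add_zero] at hlim
  exact hcl.mem_of_tendsto hlim (Filter.Eventually.of_forall fun N => hind (N + 1))

lemma gm_algebra (M : Ideal B) (r : ℂ) (hr : r ≠ 0) (e₁ e₂ X Y : B) (hc : e₁ * e₂ = e₂ * e₁)
    (m1 : (e₁ - 1) * X - r⁻¹ • (1 : B) ∈ M) (m2 : (1 - e₂) * Y - r • e₂ ∈ M) :
    1 - (e₂ + (r * r) • ((e₁ - 1) * e₂) + r • ((e₁ - 1) * (1 - e₂) * (X - Y))) ∈ M := by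
  have hcc : (1 - e₂) * (e₁ - 1) = (e₁ - 1) * (1 - e₂) := by
    simp only [sub_mul, mul_sub, hc, one_mul, mul_one]; abel
  have m3 : (e₁ - 1) * (1 - e₂) * (X - Y) - r⁻¹ • (1 - e₂) + r • ((e₁ - 1) * e₂)
      ∈ M := by
    have := M.sub_mem (M.mul_mem_left (1 - e₂) m1) (M.mul_mem_left (e₁ - 1) m2)
    convert this using 1
    rw [mul_sub (1 - e₂) _ (r⁻¹ • (1 : B)), mul_sub (e₁ - 1) _ (r • e₂), ← mul_assoc (1 - e₂), hcc,
      ← mul_assoc (e₁ - 1) (1 - e₂), mul_smul_comm,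
      mul_smul_comm, mul_one, mul_sub _ X Y]
    abel
  have := M.mul_mem_left (algebraMap ℂ B (-r)) m3
  rw [← Algebra.smul_def] at this
  convert this using 1
  rw [smul_add, smul_sub, smul_smul, smul_smul, neg_mul, mul_inv_cancel₀ hr]
  simp only [neg_smul, one_smul, neg_mul]
  abel

set_option maxHeartbeats 1000000 in
theorem gelfand_mazur_aux (M : Ideal B) (hM : M.IsMaximal) (z zi : B) (hzc : ∀ x, z * x = x * z)
    (hzic : ∀ x, zi * x = x * zi) (hzz : zi * z = 1)
    (p K : ℝ) (hp : 0 < p) (hK : 0 ≤ K)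
    (hs : ∀ (c : ℂ) (x : B), ‖c • x‖ ≤ K * ‖c‖ ^ p * ‖x‖)
    (hz : ∀ r : ℝ, 1 < r → ∀ θ > 0, ∃ n : ℕ, 0 < n ∧ ‖((r : ℂ) ^ n)⁻¹ • z ^ n‖ ≤ θ ∧
      ‖((r : ℂ) ^ n)⁻¹ • zi ^ n‖ ≤ θ) :
    ∃ lam : ℂ, ‖lam‖ = 1 ∧ z - algebraMap ℂ B lam ∈ M := by
  by_contra! H
  have hsm : ∀ (c : ℂ) (m : B), m ∈ M → c • m ∈ M := by
    intro c m hm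
    rw [Algebra.smul_def]; exact M.mul_mem_left _ hm
  have H' : ∀ lam : Metric.sphere (0 : ℂ) 1, z - algebraMap ℂ B lam ∉ M := fun lam =>
    H lam (by simpa using lam.2)
  choose δ hδ S hS C hC hbd using fun lam : Metric.sphere (0 : ℂ) 1 =>
    res_mem M hM z hzc p K hp hK hs lam (H' lam)
  have hcomp : IsCompact (Metric.sphere (0 : ℂ) 1) := isCompact_sphere _ _
  obtain ⟨t, ht⟩ := hcomp.elim_nhds_subcover' (fun x hx => Metric.ball x (δ ⟨x, hx⟩))
    (fun x hx => Metric.ball_mem_nhds _ (hδ _))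
  obtain ⟨ρ, hρ, hleb⟩ := lebesgue_number_lemma_of_metric (ι := t)
    (c := fun k => Metric.ball (k : ℂ) (δ k)) hcomp (fun _ => Metric.isOpen_ball) (by
      intro y hy
      have := ht hy
      simp only [Set.mem_iUnion] at this ⊢
      obtain ⟨i, hi, h⟩ := this
      exact ⟨⟨i, hi⟩, h⟩)
  set Ct : ℝ := ∑ k ∈ t, C k with hCt
  have hCt0 : 0 ≤ Ct := Finset.sum_nonneg fun k _ => hC k
  set L : ℝ := 1 + ‖(1 : B)‖ with hL
  have hL0 : 0 ≤ L := by positivity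
  set K₁ : ℝ := K * 4 ^ p with hK₁
  have hK₁0 : 0 ≤ K₁ := by positivity
  set θ : ℝ := 1 / (4 * (1 + K₁ * L)) with hθ
  set ε : ℝ := 1 / (4 * (1 + K₁ * L ^ 2)) with hε
  have hθ0 : 0 < θ := by positivity
  have hε0 : 0 < ε := by positivity
  have hθ1 : θ + K₁ * L * θ = 1 / 4 := by rw [hθ]; field_simp
  have hε1 : ε + K₁ * L ^ 2 * ε = 1 / 4 := by rw [hε]; field_simp
  have hθle : θ ≤ 1 := by
    have : 0 ≤ K₁ * L * θ := by positivity
    linarith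
  set η : ℝ := min (ρ / 2) (min 1 ((ε / (Ct + 1)) ^ (p⁻¹))) with hη
  have hη0 : 0 < η := by positivity
  have hη1 : η ≤ 1 := (min_le_right _ _).trans (min_le_left _ _)
  have hηρ : η < ρ := by
    have : η ≤ ρ / 2 := min_le_left _ _
    linarith
  have hηp : Ct * η ^ p ≤ ε := by
    have h1 : η ^ p ≤ ε / (Ct + 1) := by
      calc η ^ p ≤ ((ε / (Ct + 1)) ^ (p⁻¹)) ^ p := by
            gcongr
            exact (min_le_right _ _).trans (min_le_right _ _)
        _ = _ := Real.rpow_inv_rpow (by positivity) hp.ne'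
    calc Ct * η ^ p ≤ Ct * (ε / (Ct + 1)) := by gcongr
      _ ≤ (Ct + 1) * (ε / (Ct + 1)) := by gcongr; linarith
      _ = ε := by field_simp
  set r : ℝ := 1 + η / 2 with hr
  have hr1 : 1 < r := by linarith
  have hr2 : r ≤ 2 := by linarith
  have hrpos : 0 < r := by linarith
  have hri1 : r⁻¹ < 1 := inv_lt_one_of_one_lt₀ hr1
  have hri : 1 - r⁻¹ ≤ η / 2 := by
    have : 1 - r⁻¹ = (η / 2) / r := by field_simp; rw [hr]; ring
    rw [this]
    exact div_le_self (by positivity) hr1.le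
  obtain ⟨n, hn, he1, he2⟩ := hz r hr1 θ hθ0
  set ζ : ℂ := Complex.exp (2 * Real.pi * Complex.I / n) with hζd
  have hζ : IsPrimitiveRoot ζ n := Complex.isPrimitiveRoot_exp n hn.ne'
  have hζn : ∀ l : ℕ, ‖ζ ^ l‖ = 1 := by
    intro l
    rw [norm_pow, hζ.norm'_eq_one hn.ne', one_pow]
  have hζs : ∀ l : ℕ, ζ ^ l ∈ Metric.sphere (0 : ℂ) 1 := by
    intro l; simpa using hζn l
  choose k hk using fun l : ℕ => hleb (ζ ^ l) (hζs l)
  set c : ℕ → ℂ := fun l => (n : ℂ)⁻¹ * ζ ^ l with hc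
  have hcn : ∀ l, ‖c l‖ = (n : ℝ)⁻¹ := by
    intro l
    simp only [hc]; rw [norm_mul, hζn]; simp
  have hnC : (n : ℝ) ≠ 0 := by exact_mod_cast hn.ne'
  let X : ℝ → B := fun a => ∑ l ∈ Finset.range n, c l • S (k l) (a * ζ ^ l)
  have hin : ∀ a : ℝ, |a - 1| < ρ → ∀ l : ℕ, (a : ℂ) * ζ ^ l ∈ Metric.ball ((k l : Metric.sphere (0:ℂ) 1) : ℂ) (δ (k l)) := by
    intro a ha l
    apply hk l
    rw [mem_ball_iff_norm]
    have : (a : ℂ) * ζ ^ l - ζ ^ l = ((a - 1 : ℝ) : ℂ) * ζ ^ l := by push_cast; ring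
    rw [this, norm_mul, hζn, mul_one, Complex.norm_real]
    exact ha
  have hX : ∀ a : ℝ, |a - 1| < ρ →
      (z ^ n - algebraMap ℂ B ((a : ℂ) ^ n)) * X a - algebraMap ℂ B ((a : ℂ) ^ (n - 1)) ∈ M := by
    intro a ha
    rw [← roots_sum n hn ζ hζ (a : ℂ) z]
    simp only [X]
    rw [Finset.mul_sum, ← Finset.sum_sub_distrib]
    refine M.sum_mem fun l _ => ?_
    rw [mul_smul_comm, ← smul_sub]
    refine hsm _ _ ?_
    set μ : ℂ := (a : ℂ) * ζ ^ l with hμ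
    have e1 : (a : ℂ) ^ n = μ ^ n := by
      rw [hμ, mul_pow, ← pow_mul, mul_comm l, pow_mul, hζ.pow_eq_one, one_pow, mul_one]
    have e2 : z ^ n - algebraMap ℂ B ((a : ℂ) ^ n) =
        (∑ i ∈ Finset.range n, μ ^ (n - 1 - i) • z ^ i) * (z - algebraMap ℂ B μ) := by
      have hcm : Commute z (algebraMap ℂ B μ) := (Algebra.commutes μ z).symm
      rw [e1, map_pow, ← hcm.geom_sum₂_mul n]
      congr 1
      refine Finset.sum_congr rfl fun i _ => ?_
      rw [Algebra.smul_def, map_pow]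
      exact ((hcm.pow_pow _ _))
    rw [e2, mul_assoc]
    have e3 : ∀ P Y : B, P * Y - P = P * (Y - 1) := by intro P Y; rw [mul_sub, mul_one]
    rw [e3]
    exact M.mul_mem_left _ (hS (k l) μ (hin a ha l))
  have hρ1 : |r - 1| < ρ := by
    rw [abs_of_pos (by linarith)]; linarith
  have hρ2 : |r⁻¹ - 1| < ρ := by
    rw [abs_of_neg (by linarith)]; linarith
  have hdiff : ‖X r - X r⁻¹‖ ≤ ε := by
    refine le_trans ?_ hηp
    simp only [X]
    rw [← Finset.sum_sub_distrib]
    simp_rw [← smul_sub]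
    rw [← Finset.sum_fiberwise_of_maps_to (s := Finset.range n) (t := t)
      (g := fun l => (k l : Metric.sphere (0:ℂ) 1)) (fun l _ => (k l).2)]
    refine (norm_sum_le _ _).trans ?_
    rw [hCt, Finset.sum_mul]
    refine Finset.sum_le_sum fun j hj => ?_
    have e : ∑ l ∈ (Finset.range n).filter (fun l => (k l : Metric.sphere (0:ℂ) 1) = j),
        c l • (S (k l) (r * ζ ^ l) - S (k l) ((r⁻¹ : ℝ) * ζ ^ l)) =
        ∑ l ∈ (Finset.range n).filter (fun l => (k l : Metric.sphere (0:ℂ) 1) = j),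
        c l • (S j (r * ζ ^ l) - S j ((r⁻¹ : ℝ) * ζ ^ l)) := by
      refine Finset.sum_congr rfl fun l hl => ?_
      rw [(Finset.mem_filter.1 hl).2]
    rw [e]
    refine hbd j _ c (fun l => r * ζ ^ l) (fun l => (r⁻¹ : ℝ) * ζ ^ l) η hη0.le ?_ ?_ ?_ ?_
    · calc _ ≤ ∑ l ∈ Finset.range n, ‖c l‖ :=
            Finset.sum_le_sum_of_subset_of_nonneg (Finset.filter_subset _ _)
              (fun _ _ _ => norm_nonneg _)
        _ = 1 := by simp [hcn, hnC]
        _ ≤ 1 := le_rfl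
    · intro l hl
      rw [← (Finset.mem_filter.1 hl).2]
      exact hin r hρ1 l
    · intro l hl
      rw [← (Finset.mem_filter.1 hl).2]
      exact hin r⁻¹ hρ2 l
    · intro l _
      have : (r : ℂ) * ζ ^ l - (r⁻¹ : ℝ) * ζ ^ l = ((r - r⁻¹ : ℝ) : ℂ) * ζ ^ l := by
        push_cast; ring
      rw [this, norm_mul, hζn, mul_one, Complex.norm_real, Real.norm_eq_abs,
        abs_of_pos (by linarith)]
      linarith
  obtain ⟨e₁, he₁⟩ : ∃ x, x = ((r : ℂ) ^ n)⁻¹ • z ^ n := ⟨_, rfl⟩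
  obtain ⟨e₂, he₂⟩ : ∃ x, x = ((r : ℂ) ^ n)⁻¹ • zi ^ n := ⟨_, rfl⟩
  rw [← he₁] at he1
  rw [← he₂] at he2
  have hrC : (r : ℂ) ≠ 0 := by exact_mod_cast hrpos.ne'
  have hzicn : ∀ (m : ℕ) (x : B), zi ^ m * x = x * zi ^ m := fun m x =>
    ((show Commute zi x from hzic x).pow_left m)
  have hzcn : ∀ (m : ℕ) (x : B), z ^ m * x = x * z ^ m := fun m x =>
    ((show Commute z x from hzc x).pow_left m)
  have he₁c : ∀ x, e₁ * x = x * e₁ := by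
    intro x; rw [he₁, smul_mul_assoc, hzcn, mul_smul_comm]
  have he₂c : ∀ x, e₂ * x = x * e₂ := by
    intro x; rw [he₂, smul_mul_assoc, hzicn, mul_smul_comm]
  have hzzn : zi ^ n * z ^ n = 1 := by
    rw [← (show Commute zi z from hzic z).mul_pow, hzz, one_pow]
  have hpn : (r : ℂ) ^ n = r ^ (n - 1) * r := by
    rw [← pow_succ]; congr 1; omega
  have hsc1 : ((r : ℂ) ^ n)⁻¹ * (r : ℂ) ^ (n - 1) = (r : ℂ)⁻¹ := by
    rw [hpn, mul_inv, mul_right_comm, inv_mul_cancel₀ (pow_ne_zero _ hrC), one_mul]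
  have m1 : (e₁ - 1) * X r - (r : ℂ)⁻¹ • (1 : B) ∈ M := by
    have := hsm ((r : ℂ) ^ n)⁻¹ _ (hX r hρ1)
    rwa [smul_sub, ← smul_mul_assoc, smul_sub, Algebra.algebraMap_eq_smul_one,
      Algebra.algebraMap_eq_smul_one, smul_smul, smul_smul, inv_mul_cancel₀ (pow_ne_zero _ hrC),
      one_smul, hsc1, ← he₁] at this
  have m2 : (1 - e₂) * X r⁻¹ - (r : ℂ) • e₂ ∈ M := by
    have := M.mul_mem_left (zi ^ n) (hX r⁻¹ hρ2)
    have e3 : ((r⁻¹ : ℝ) : ℂ) ^ (n - 1) = (r : ℂ) * ((r : ℂ) ^ n)⁻¹ := by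
      rw [hpn]; push_cast; rw [inv_pow]; field_simp
    have e4 : ((r⁻¹ : ℝ) : ℂ) ^ n = ((r : ℂ) ^ n)⁻¹ := by
      push_cast; rw [inv_pow]
    rwa [mul_sub, ← mul_assoc, mul_sub, hzzn, Algebra.algebraMap_eq_smul_one,
      Algebra.algebraMap_eq_smul_one, mul_smul_comm, mul_smul_comm, mul_one, e3, e4, mul_smul,
      ← he₂] at this
  have m4 := gm_algebra M (r : ℂ) hrC e₁ e₂ (X r) (X r⁻¹) (he₁c e₂) m1 m2
  obtain ⟨y, hy⟩ : ∃ y, y = e₂ + ((r : ℂ) * r) • ((e₁ - 1) * e₂) +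
      (r : ℂ) • ((e₁ - 1) * (1 - e₂) * (X r - X r⁻¹)) := ⟨_, rfl⟩
  rw [← hy] at m4
  have b1 : ‖e₁ - 1‖ ≤ L := (norm_sub_le _ _).trans (by rw [hL]; linarith)
  have b2 : ‖1 - e₂‖ ≤ L := (norm_sub_le _ _).trans (by rw [hL]; linarith)
  have hs4 : ∀ (c : ℂ) (x : B), ‖c‖ ≤ 4 → ‖c • x‖ ≤ K₁ * ‖x‖ := by
    intro c x hc
    refine (hs c x).trans ?_
    rw [hK₁]
    gcongr
  have hrn : ‖(r : ℂ)‖ = r := by rw [Complex.norm_real, Real.norm_of_nonneg hrpos.le]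
  have b3 : ‖((r : ℂ) * r) • ((e₁ - 1) * e₂)‖ ≤ K₁ * (L * θ) := by
    refine (hs4 _ _ ?_).trans ?_
    · rw [norm_mul, hrn]; nlinarith
    · gcongr
      refine (norm_mul_le _ _).trans ?_
      gcongr
  have b4 : ‖(r : ℂ) • ((e₁ - 1) * (1 - e₂) * (X r - X r⁻¹))‖ ≤ K₁ * (L * L * ε) := by
    refine (hs4 _ _ ?_).trans ?_
    · rw [hrn]; linarith
    · gcongr
      refine (norm_mul_le _ _).trans ?_
      gcongr
      refine (norm_mul_le _ _).trans ?_
      gcongr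
  have hylt : ‖y‖ < 1 := by
    have h1 : ‖y‖ ≤ θ + K₁ * (L * θ) + K₁ * (L * L * ε) := by
      rw [hy]
      refine (norm_add₃_le).trans ?_
      gcongr
    have h2 : K₁ * (L * θ) = K₁ * L * θ := by ring
    have h3 : K₁ * (L * L * ε) = K₁ * L ^ 2 * ε := by ring
    linarith
  exact hM.ne_top (M.eq_top_of_isUnit_mem m4 ((Units.oneSub y hylt).isUnit))

end GM

section WL

/-- Finitely supported Laurent polynomials, to be normed by a weight. -/
def WLP (_w : ℤ → ℝ) (R : Type*) [NormedRing R] : Type _ := AddMonoidAlgebra R ℤ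

noncomputable instance (w : ℤ → ℝ) (R : Type*) [NormedRing R] : Ring (WLP w R) :=
  inferInstanceAs (Ring (AddMonoidAlgebra R ℤ))

/-- The weighted norm. -/
noncomputable def wnorm (w : ℤ → ℝ) {R : Type*} [NormedRing R] (x : AddMonoidAlgebra R ℤ) : ℝ :=
  x.coeff.sum fun n a => w n * ‖a‖

lemma wnorm_eq (w : ℤ → ℝ) {R : Type*} [NormedRing R] (x : AddMonoidAlgebra R ℤ)
    (s : Finset ℤ) (hs : x.coeff.support ⊆ s) : wnorm w x = ∑ n ∈ s, w n * ‖x.coeff n‖ :=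
  Finsupp.sum_of_support_subset _ hs _ (by simp)

lemma wnorm_single (w : ℤ → ℝ) {R : Type*} [NormedRing R] (n : ℤ) (a : R) :
    wnorm w (AddMonoidAlgebra.single n a) = w n * ‖a‖ := by
  unfold wnorm
  rw [AddMonoidAlgebra.coeff_single, Finsupp.sum_single_index]
  simp

lemma wnorm_nonneg {w : ℤ → ℝ} (hw : IsWeight w) {R : Type*} [NormedRing R]
    (x : AddMonoidAlgebra R ℤ) : 0 ≤ wnorm w x :=
  Finset.sum_nonneg fun n _ => mul_nonneg (zero_le_one.trans (hw.1 n)) (norm_nonneg _)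

lemma wnorm_add {w : ℤ → ℝ} (hw : IsWeight w) {R : Type*} [NormedRing R]
    (x y : AddMonoidAlgebra R ℤ) : wnorm w (x + y) ≤ wnorm w x + wnorm w y := by
  classical
  rw [wnorm_eq w x (x.coeff.support ∪ y.coeff.support) Finset.subset_union_left,
    wnorm_eq w y (x.coeff.support ∪ y.coeff.support) Finset.subset_union_right,
    wnorm_eq w (x + y) (x.coeff.support ∪ y.coeff.support) (by
      rw [AddMonoidAlgebra.coeff_add]; exact Finsupp.support_add), ← Finset.sum_add_distrib]
  refine Finset.sum_le_sum fun n _ => ?_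
  rw [AddMonoidAlgebra.coeff_add, Finsupp.add_apply, ← mul_add]
  exact mul_le_mul_of_nonneg_left (norm_add_le _ _) (zero_le_one.trans (hw.1 n))

lemma wnorm_zero (w : ℤ → ℝ) {R : Type*} [NormedRing R] :
    wnorm w (0 : AddMonoidAlgebra R ℤ) = 0 := by
  simp [wnorm]

lemma wnorm_sum {w : ℤ → ℝ} (hw : IsWeight w) {R : Type*} [NormedRing R] {ι : Type*}
    (s : Finset ι) (f : ι → AddMonoidAlgebra R ℤ) :
    wnorm w (∑ i ∈ s, f i) ≤ ∑ i ∈ s, wnorm w (f i) := by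
  classical
  induction s using Finset.induction_on with
  | empty => simp [wnorm_zero]
  | insert a s ha ih =>
    rw [Finset.sum_insert ha, Finset.sum_insert ha]
    exact (wnorm_add hw _ _).trans (by linarith)

lemma wnorm_mul {w : ℤ → ℝ} (hw : IsWeight w) {R : Type*} [NormedRing R]
    (x y : AddMonoidAlgebra R ℤ) : wnorm w (x * y) ≤ wnorm w x * wnorm w y := by
  classical
  rw [AddMonoidAlgebra.mul_def]
  unfold Finsupp.sum
  refine (wnorm_sum hw _ _).trans ?_
  have : wnorm w x * wnorm w y = ∑ i ∈ x.coeff.support, ∑ j ∈ y.coeff.support,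
      (w i * ‖x.coeff i‖) * (w j * ‖y.coeff j‖) := by
    unfold wnorm Finsupp.sum
    rw [Finset.sum_mul_sum]
  rw [this]
  refine Finset.sum_le_sum fun i _ => (wnorm_sum hw _ _).trans (Finset.sum_le_sum fun j _ => ?_)
  rw [wnorm_single]
  calc w (i + j) * ‖x.coeff i * y.coeff j‖ ≤ (w i * w j) * (‖x.coeff i‖ * ‖y.coeff j‖) :=
        mul_le_mul (hw.2 i j) (norm_mul_le _ _) (norm_nonneg _)
          (mul_nonneg (zero_le_one.trans (hw.1 i)) (zero_le_one.trans (hw.1 j)))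
    _ = _ := by ring

lemma wnorm_coeff {w : ℤ → ℝ} (hw : IsWeight w) {R : Type*} [NormedRing R]
    (x : AddMonoidAlgebra R ℤ) (s : Finset ℤ) : ∑ n ∈ s, w n * ‖x.coeff n‖ ≤ wnorm w x := by
  classical
  rw [wnorm_eq w x (x.coeff.support ∪ s) Finset.subset_union_left]
  exact Finset.sum_le_sum_of_subset_of_nonneg Finset.subset_union_right
    fun n _ _ => mul_nonneg (zero_le_one.trans (hw.1 n)) (norm_nonneg _)

/-- The weighted norm as a ring norm. -/
noncomputable def wRingNorm {w : ℤ → ℝ} (hw : IsWeight w) (R : Type*) [NormedRing R] :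
    RingNorm (WLP w R) where
  toFun x := wnorm w (R := R) x
  map_zero' := wnorm_zero w
  add_le' x y := wnorm_add hw (R := R) x y
  neg' x := by
    classical
    change wnorm w (R := R) (-(show AddMonoidAlgebra R ℤ from x)) = wnorm w (R := R) x
    set y : AddMonoidAlgebra R ℤ := x
    rw [wnorm_eq w y y.coeff.support subset_rfl, wnorm_eq w (-y) y.coeff.support (by simp)]
    simp
  mul_le' x y := wnorm_mul hw (R := R) x y
  eq_zero_of_map_eq_zero' x hx := by
    change wnorm w (R := R) x = 0 at hx
    have : ∀ n, (show AddMonoidAlgebra R ℤ from x).coeff n = 0 := by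
      intro n
      have h := wnorm_coeff hw (R := R) x {n}
      rw [hx, Finset.sum_singleton] at h
      have h1 := hw.1 n
      have h2 := norm_nonneg ((show AddMonoidAlgebra R ℤ from x).coeff n)
      exact norm_le_zero_iff.1 (by nlinarith)
    exact AddMonoidAlgebra.ext (Finsupp.ext this)

noncomputable instance {w : ℤ → ℝ} [hw : Fact (IsWeight w)] (R : Type*) [NormedRing R] :
    NormedRing (WLP w R) := RingNorm.toNormedRing (wRingNorm hw.1 R)

lemma WLP.norm_def {w : ℤ → ℝ} [hw : Fact (IsWeight w)] {R : Type*} [NormedRing R]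
    (x : WLP w R) : ‖x‖ = wnorm w (R := R) x := rfl

/-- single -/
noncomputable def WLP.single (w : ℤ → ℝ) {R : Type*} [NormedRing R] (n : ℤ) (a : R) : WLP w R :=
  AddMonoidAlgebra.single n a

lemma WLP.induction {w : ℤ → ℝ} {R : Type*} [NormedRing R] {P : WLP w R → Prop} (x : WLP w R)
    (h0 : P 0) (ha : ∀ x y, P x → P y → P (x + y)) (hs : ∀ n a, P (WLP.single w n a)) : P x :=
  AddMonoidAlgebra.induction_linear (motive := P) x h0 (fun x y => ha x y) (fun n a => hs n a)

lemma WLP.single_mul (w : ℤ → ℝ) {R : Type*} [NormedRing R] (n m : ℤ) (a b : R) :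
    WLP.single w n a * WLP.single w m b = WLP.single w (n + m) (a * b) :=
  AddMonoidAlgebra.single_mul_single ..

lemma WLP.single_add (w : ℤ → ℝ) {R : Type*} [NormedRing R] (n : ℤ) (a b : R) :
    WLP.single w n (a + b) = WLP.single w n a + WLP.single w n b :=
  AddMonoidAlgebra.single_add ..

lemma WLP.single_one (w : ℤ → ℝ) {R : Type*} [NormedRing R] :
    WLP.single w 0 (1 : R) = 1 := rfl

variable (w : ℤ → ℝ) [hw : Fact (IsWeight w)] {R : Type*} [NormedRing R]

/-- The weighted Wiener algebra. -/
abbrev WB (w : ℤ → ℝ) [Fact (IsWeight w)] (R : Type*) [NormedRing R] : Type _ :=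
  UniformSpace.Completion (WLP w R)

/-- monomials -/
noncomputable def mono (n : ℤ) (a : R) : WB w R := ((WLP.single w n a : WLP w R) : WB w R)

lemma norm_mono (n : ℤ) (a : R) : ‖mono w n a‖ = w n * ‖a‖ := by
  unfold mono
  rw [UniformSpace.Completion.norm_coe, WLP.norm_def]
  exact wnorm_single w n a

lemma mono_mul (n m : ℤ) (a b : R) : mono w n a * mono w m b = mono w (n + m) (a * b) := by
  unfold mono
  rw [← UniformSpace.Completion.coe_mul, WLP.single_mul]

lemma mono_add (n : ℤ) (a b : R) : mono w n (a + b) = mono w n a + mono w n b := by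
  unfold mono
  rw [← UniformSpace.Completion.coe_add, WLP.single_add]

lemma mono_one : mono w 0 (1 : R) = 1 := by
  unfold mono
  rw [WLP.single_one, UniformSpace.Completion.coe_one]

/-- additive monomial map -/
noncomputable def monoHom (n : ℤ) : R →+ WB w R := AddMonoidHom.mk' (mono w n) (mono_add w n)

lemma continuous_mono (n : ℤ) : Continuous (mono w n : R → WB w R) :=
  AddMonoidHomClass.continuous_of_bound (monoHom w n) (w n) fun x => (norm_mono w n x).le

lemma WB.induction {P : WB w R → Prop} (x : WB w R) (hc : IsClosed {x | P x})
    (h0 : P 0) (ha : ∀ x y, P x → P y → P (x + y)) (hs : ∀ n a, P (mono w n a)) : P x := by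
  refine UniformSpace.Completion.induction_on x hc fun y => ?_
  refine WLP.induction (P := fun y => P (y : WB w R)) y (by rw [UniformSpace.Completion.coe_zero]; exact h0) ?_ hs
  intro x y hx hy
  rw [UniformSpace.Completion.coe_add]
  exact ha _ _ hx hy

lemma mono_central (n : ℤ) (a : R) (h : ∀ b, a * b = b * a) (x : WB w R) :
    mono w n a * x = x * mono w n a := by
  refine WB.induction w (P := fun x => mono w n a * x = x * mono w n a) x ?_ ?_ ?_ ?_
  · exact isClosed_eq (continuous_const.mul continuous_id) (continuous_id.mul continuous_const)
  · rw [mul_zero, zero_mul]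
  · intro x y hx hy
    rw [mul_add, add_mul, hx, hy]
  · intro m b
    rw [mono_mul, mono_mul, h, add_comm]

/-- the scalars -/
noncomputable def scal [Algebra ℂ R] : ℂ →+* WB w R where
  toFun c := mono w 0 (algebraMap ℂ R c)
  map_one' := by rw [map_one, mono_one]
  map_zero' := by rw [map_zero]; exact (monoHom w 0).map_zero
  map_add' x y := by rw [map_add, mono_add]
  map_mul' x y := by rw [map_mul, mono_mul, add_zero]

noncomputable instance [Algebra ℂ R] : Algebra ℂ (WB w R) :=
  (scal w).toAlgebra' fun c x => mono_central w 0 _ (Algebra.commutes c) x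

end WL

section WL2

lemma coef_exists (w : ℤ → ℝ) [hw : Fact (IsWeight w)] (R : Type*) [NormedRing R]
    [CompleteSpace R] : ∃ c : ℤ → (WB w R →+ R), (∀ n, Continuous (c n)) ∧
      (∀ n m a, c n (mono w m a) = if n = m then a else 0) ∧
      ∀ x (s : Finset ℤ), ∑ n ∈ s, w n * ‖c n x‖ ≤ ‖x‖ := by
  classical
  let c0 : ℤ → (WLP w R →+ R) := fun n =>
    { toFun := fun x => AddMonoidAlgebra.coeff (R := R) x n
      map_zero' := rfl
      map_add' := fun x y => rfl }
  have hc0 : ∀ n x, ‖c0 n x‖ ≤ 1 * ‖x‖ := by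
    intro n x
    have h := wnorm_coeff hw.1 (R := R) x {n}
    rw [Finset.sum_singleton] at h
    rw [one_mul, WLP.norm_def]
    refine le_trans ?_ h
    exact le_mul_of_one_le_left (norm_nonneg _) (hw.1.1 n)
  let c1 : ℤ → NormedAddGroupHom (WB w R) R := fun n =>
    ((c0 n).mkNormedAddGroupHom 1 (hc0 n)).extension
  have hc1 : ∀ n (x : WLP w R), c1 n (x : WB w R) = c0 n x := fun n x =>
    NormedAddGroupHom.extension_coe _ _
  refine ⟨fun n => (c1 n).toAddMonoidHom, fun n => (c1 n).continuous, ?_, ?_⟩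
  · intro n m a
    refine (hc1 n (WLP.single w m a)).trans ?_
    change (Finsupp.single m a) n = _
    rw [Finsupp.single_apply]
    simp only [eq_comm]
  · intro x s
    change ∑ n ∈ s, w n * ‖c1 n x‖ ≤ ‖x‖
    refine UniformSpace.Completion.induction_on x ?_ ?_
    · refine isClosed_le ?_ continuous_norm
      exact continuous_finsetSum _ fun n _ => continuous_const.mul (c1 n).continuous.norm
    · intro x
      simp only [hc1]
      rw [UniformSpace.Completion.norm_coe, WLP.norm_def]
      exact wnorm_coeff hw.1 (R := R) x s

lemma eval_exists (w : ℤ → ℝ) [hw : Fact (IsWeight w)] (R : Type*) [NormedRing R]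
    [CompleteSpace R] [Algebra ℂ R] (p : ℝ) (hs : ∀ (c : ℂ) (a : R), ‖c • a‖ ≤ ‖c‖ ^ p * ‖a‖)
    (lam : ℂ) (hl : ‖lam‖ = 1) :
    ∃ e : WB w R →+* R, Continuous e ∧ ∀ n a, e (mono w n a) = lam ^ n • a := by
  classical
  have hl0 : lam ≠ 0 := by
    intro h; rw [h, norm_zero] at hl; exact zero_ne_one hl
  let g : Multiplicative ℤ →* R :=
    { toFun := fun n => algebraMap ℂ R (lam ^ n.toAdd)
      map_one' := by simp
      map_mul' := fun x y => by rw [toAdd_mul, zpow_add₀ hl0, map_mul] }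
  let e0 : WLP w R →+* R := AddMonoidAlgebra.liftNCRingHom (RingHom.id R) g
    (fun x y => (Algebra.commutes _ x).symm)
  have he0 : ∀ n a, e0 (WLP.single w n a) = lam ^ n • a := by
    intro n a
    rw [Algebra.smul_def, Algebra.commutes]
    exact AddMonoidAlgebra.liftNC_single _ _ _ _
  have hn : ∀ n (a : R), ‖lam ^ n • a‖ ≤ w n * ‖a‖ := by
    intro n a
    refine (hs _ _).trans ?_
    rw [norm_zpow, hl, one_zpow, Real.one_rpow]
    exact mul_le_mul_of_nonneg_right (hw.1.1 n) (norm_nonneg _)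
  have hb : ∀ x, ‖e0 x‖ ≤ 1 * ‖x‖ := by
    intro x
    have hx : x = ∑ n ∈ (AddMonoidAlgebra.coeff (R := R) x).support,
        WLP.single w n (AddMonoidAlgebra.coeff (R := R) x n) :=
      (AddMonoidAlgebra.sum_coeff_single (R := R) x).symm
    rw [one_mul, WLP.norm_def]
    conv_lhs => rw [hx, map_sum]
    refine (norm_sum_le _ _).trans ?_
    unfold wnorm Finsupp.sum
    refine Finset.sum_le_sum fun n _ => ?_
    rw [he0]
    exact hn _ _
  have hc : Continuous e0 := AddMonoidHomClass.continuous_of_bound e0 1 hb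
  refine ⟨UniformSpace.Completion.extensionHom e0 hc, UniformSpace.Completion.continuous_extension,
    fun n a => ?_⟩
  rw [← he0]
  exact UniformSpace.Completion.extensionHom_coe e0 hc _

lemma mono_sub_mem (w : ℤ → ℝ) [hw : Fact (IsWeight w)] (R : Type*) [NormedRing R]
    [Algebra ℂ R] (M : Ideal (WB w R)) (lam : ℂ) (hl : lam ≠ 0)
    (hz : mono w 1 (1 : R) - algebraMap ℂ (WB w R) lam ∈ M) (n : ℤ) (a : R) :
    mono w n a - mono w 0 (lam ^ n • a) ∈ M := by
  have key : ∀ (m : ℤ) (b : R), mono w (m + 1) b - mono w m (lam • b) ∈ M := by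
    intro m b
    have h := M.mul_mem_left (mono w m b) hz
    have h2 : mono w m b * algebraMap ℂ (WB w R) lam = mono w m (lam • b) := by
      change mono w m b * mono w 0 (algebraMap ℂ R lam) = _
      rw [mono_mul, add_zero, ← Algebra.commutes, ← Algebra.smul_def]
    rwa [mul_sub, h2, mono_mul, mul_one] at h
  induction n using Int.induction_on generalizing a with
  | zero => simp
  | succ k ih =>
    have := M.add_mem (key k a) (ih (lam • a))
    rw [sub_add_sub_cancel, smul_smul, ← zpow_add_one₀ hl] at this
    exact this
  | pred k ih =>
    have h1 := key (-(k : ℤ) - 1) (lam⁻¹ • a)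
    rw [sub_add_cancel, smul_smul, mul_inv_cancel₀ hl, one_smul] at h1
    have := M.sub_mem (ih (lam⁻¹ • a)) h1
    rw [sub_sub_sub_cancel_left, smul_smul, ← zpow_sub_one₀ hl] at this
    exact this

theorem abs_wiener (w : ℤ → ℝ) (hw : IsWeight w) (R : Type*) [NormedRing R]
    [CompleteSpace R] [Algebra ℂ R] (p : ℝ) (hp : 0 < p)
    (hs : ∀ (c : ℂ) (a : R), ‖c • a‖ ≤ ‖c‖ ^ p * ‖a‖)
    (hadm : ∀ r : ℝ, 1 < r → ∀ θ > 0, ∃ n : ℕ, 0 < n ∧ w n * ((r ^ n)⁻¹) ^ p ≤ θ ∧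
      w (-(n : ℤ)) * ((r ^ n)⁻¹) ^ p ≤ θ)
    (a : ℤ → R) (ha : Summable fun n => w n * ‖a n‖)
    (hinv : ∀ lam : ℂ, ‖lam‖ = 1 → ∀ s, HasSum (fun n => lam ^ n • a n) s → ∃ u, u * s = 1) :
    ∃ b : ℤ → R, (Summable fun n => w n * ‖b n‖) ∧ ∀ lam : ℂ, ‖lam‖ = 1 → ∀ s t,
      HasSum (fun n => lam ^ n • a n) s → HasSum (fun n => lam ^ n • b n) t → t * s = 1 := by
  classical
  have : Fact (IsWeight w) := ⟨hw⟩
  have hw0 : ∀ n, 0 ≤ w n := fun n => zero_le_one.trans (hw.1 n)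
  obtain ⟨c, hcc, hcm, hcs⟩ := coef_exists w R
  have hF : Summable fun n => mono w n (a n) :=
    Summable.of_norm (by simpa only [norm_mono] using ha)
  set F : WB w R := ∑' n, mono w n (a n) with hFdef
  have hsB : ∀ (k : ℂ) (x : WB w R), ‖k • x‖ ≤ (w 0 * ‖(1 : R)‖) * ‖k‖ ^ p * ‖x‖ := by
    intro k x
    rw [Algebra.smul_def]
    refine (norm_mul_le _ _).trans (mul_le_mul_of_nonneg_right ?_ (norm_nonneg _))
    change ‖mono w 0 (algebraMap ℂ R k)‖ ≤ _
    rw [norm_mono, Algebra.algebraMap_eq_smul_one, mul_assoc]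
    refine mul_le_mul_of_nonneg_left ?_ (hw0 0)
    rw [mul_comm ‖(1 : R)‖]
    exact hs _ _
  have hsm : ∀ (k : ℂ) n (b : R), k • mono w n b = mono w n (k • b) := by
    intro k n b
    rw [Algebra.smul_def, Algebra.smul_def]
    change mono w 0 (algebraMap ℂ R k) * _ = _
    rw [mono_mul, zero_add]
  have hpow1 : ∀ n : ℕ, (mono w 1 (1 : R)) ^ n = mono w n 1 := by
    intro n
    induction n with
    | zero => rw [pow_zero]; exact (mono_one w).symm
    | succ n ih => rw [pow_succ, ih, mono_mul, mul_one]; push_cast; rfl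
  have hpow2 : ∀ n : ℕ, (mono w (-1) (1 : R)) ^ n = mono w (-(n : ℤ)) 1 := by
    intro n
    induction n with
    | zero => rw [pow_zero]; exact (mono_one w).symm
    | succ n ih =>
      rw [pow_succ, ih, mono_mul, mul_one]; congr 1; push_cast; ring
  have hnb : ∀ (r : ℝ) (n : ℕ) (m : ℤ), 1 < r → ‖((r : ℂ) ^ n)⁻¹ • mono w m (1 : R)‖ ≤
      (w m * ((r ^ n)⁻¹) ^ p) * ‖(1 : R)‖ := by
    intro r n m hr
    rw [hsm, norm_mono, mul_assoc]
    refine mul_le_mul_of_nonneg_left ?_ (hw0 m)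
    refine (hs _ _).trans (le_of_eq ?_)
    rw [norm_inv, norm_pow, Complex.norm_real, Real.norm_eq_abs, abs_of_pos (by linarith)]
  have hspan : Ideal.span {F} = ⊤ := by
    by_contra hne
    obtain ⟨M, hM, hle⟩ := Ideal.exists_le_maximal _ hne
    have hFM : F ∈ M := hle (Ideal.mem_span_singleton_self F)
    obtain ⟨lam, hl, hz⟩ := gelfand_mazur_aux M hM (mono w 1 (1 : R)) (mono w (-1) (1 : R))
      (mono_central w 1 1 (by simp)) (mono_central w (-1) 1 (by simp))
      (by rw [mono_mul, mul_one]; exact mono_one w) p (w 0 * ‖(1 : R)‖) hp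
      (mul_nonneg (hw0 0) (norm_nonneg _)) hsB (by
        intro r hr θ hθ
        obtain ⟨n, hn, h1, h2⟩ := hadm r hr (θ / (‖(1 : R)‖ + 1)) (by positivity)
        have hfin : ∀ y, y ≤ θ / (‖(1 : R)‖ + 1) → y * ‖(1 : R)‖ ≤ θ := by
          intro y hy
          have h0 : 0 ≤ ‖(1 : R)‖ := norm_nonneg _
          calc y * ‖(1 : R)‖ ≤ θ / (‖(1 : R)‖ + 1) * ‖(1 : R)‖ :=
                mul_le_mul_of_nonneg_right hy h0
            _ ≤ θ / (‖(1 : R)‖ + 1) * (‖(1 : R)‖ + 1) :=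
                mul_le_mul_of_nonneg_left (by linarith) (by positivity)
            _ = θ := by field_simp
        refine ⟨n, hn, ?_, ?_⟩
        · rw [hpow1]; exact (hnb r n _ hr).trans (hfin _ h1)
        · rw [hpow2]; exact (hnb r n _ hr).trans (hfin _ h2))
    have hl0 : lam ≠ 0 := by
      intro h; rw [h, norm_zero] at hl; exact zero_ne_one hl
    have hMc : IsClosed (M : Set (WB w R)) :=
      isClosed_of_closure_subset
        (Eq.subset (congr_arg ((↑) : Ideal (WB w R) → Set (WB w R)) hM.closure_eq))
    have hsa : Summable fun n => lam ^ n • a n := by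
      refine Summable.of_norm_bounded ha fun n => ?_
      refine (hs _ _).trans ?_
      rw [norm_zpow, hl, one_zpow, Real.one_rpow]
      exact mul_le_mul_of_nonneg_right (hw.1 n) (norm_nonneg _)
    obtain ⟨u, hu⟩ := hinv lam hl _ hsa.hasSum
    have h1 : HasSum (fun n => mono w 0 (lam ^ n • a n)) (mono w 0 (∑' n, lam ^ n • a n)) :=
      hsa.hasSum.map (monoHom w 0) (continuous_mono w 0)
    have h2 := hF.hasSum.sub h1
    have h3 : F - mono w 0 (∑' n, lam ^ n • a n) ∈ M :=
      hMc.mem_of_tendsto h2 (Filter.Eventually.of_forall fun s =>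
        M.sum_mem fun n _ => mono_sub_mem w R M lam hl0 hz n (a n))
    have h4 : mono w 0 (∑' n, lam ^ n • a n) ∈ M := by
      have := M.sub_mem hFM h3
      rwa [sub_sub_cancel] at this
    have h5 := M.mul_mem_left (mono w 0 u) h4
    rw [mono_mul, hu, add_zero, mono_one] at h5
    exact hM.ne_top ((Ideal.eq_top_iff_one M).2 h5)
  obtain ⟨g, hg⟩ := Ideal.mem_span_singleton'.1 ((Ideal.eq_top_iff_one _).1 hspan)
  have hcsum : ∀ x : WB w R, Summable fun n => w n * ‖c n x‖ := fun x =>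
    summable_of_sum_le (fun n => mul_nonneg (hw0 n) (norm_nonneg _)) (hcs x)
  refine ⟨fun n => c n g, hcsum g, ?_⟩
  intro lam hl s t hS hT
  obtain ⟨e, hec, hem⟩ := eval_exists w R p hs lam hl
  have hnl : ∀ n (b : R), ‖lam ^ n • b‖ ≤ w n * ‖b‖ := by
    intro n b
    refine (hs _ _).trans ?_
    rw [norm_zpow, hl, one_zpow, Real.one_rpow]
    exact mul_le_mul_of_nonneg_right (hw.1 n) (norm_nonneg _)
  have hsl : ∀ x, Summable fun n => lam ^ n • c n x := fun x =>
    Summable.of_norm_bounded (hcsum x) fun n => hnl _ _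
  let S : WB w R →+ R := AddMonoidHom.mk' (fun x => ∑' n, lam ^ n • c n x) (by
    intro x y
    rw [← (hsl x).tsum_add (hsl y)]
    refine tsum_congr fun n => ?_
    rw [map_add, smul_add])
  have hSc : Continuous S := AddMonoidHomClass.continuous_of_bound S 1 (by
    intro x
    rw [one_mul]
    refine (tsum_of_norm_bounded (hcsum x).hasSum fun n => hnl _ _).trans ?_
    exact (hcsum x).tsum_le_of_sum_le (hcs x))
  have hSe : ∀ x, S x = e x := by
    intro x
    refine WB.induction w (P := fun x => S x = e x) x (isClosed_eq hSc hec) ?_ ?_ ?_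
    · rw [map_zero, map_zero]
    · intro x y hx hy
      rw [map_add, map_add, hx, hy]
    · intro m b
      rw [hem]
      change ∑' n, lam ^ n • c n (mono w m b) = _
      rw [tsum_eq_single m]
      · rw [hcm, if_pos rfl]
      · intro n hn
        rw [hcm, if_neg hn, smul_zero]
  have ht : t = e g := by
    rw [← hSe]; exact hT.tsum_eq.symm
  have hs' : s = e F := by
    have := hF.hasSum.map e hec
    refine hS.unique ?_
    convert this using 2 with n
    exact (hem n (a n)).symm
  rw [ht, hs', ← map_mul, hg, map_one]

end WL2

section PNs

/-- The ring `A` with the `p`-norm `‖a‖ ^ p`. -/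
def PN (_p : ℝ) (A : Type*) : Type _ := A

instance (p : ℝ) (A : Type*) [NormedRing A] : Ring (PN p A) := inferInstanceAs (Ring A)

instance (p : ℝ) (A : Type*) [NormedRing A] [NormedAlgebra ℂ A] : Algebra ℂ (PN p A) :=
  inferInstanceAs (Algebra ℂ A)

/-- The `p`-norm. -/
noncomputable def pRingNorm (p : ℝ) (hp0 : 0 < p) (hp1 : p ≤ 1) (A : Type*) [NormedRing A] :
    RingNorm (PN p A) where
  toFun x := ‖(show A from x)‖ ^ p
  map_zero' := by
    change ‖(0 : A)‖ ^ p = 0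
    rw [norm_zero, Real.zero_rpow hp0.ne']
  add_le' x y := by
    refine (Real.rpow_le_rpow (norm_nonneg _) (norm_add_le (show A from x) (show A from y))
      hp0.le).trans ?_
    exact Real.rpow_add_le_add_rpow (norm_nonneg _) (norm_nonneg _) hp0.le hp1
  neg' x := by
    change ‖-(show A from x)‖ ^ p = _
    rw [norm_neg]
  mul_le' x y := by
    rw [← Real.mul_rpow (norm_nonneg _) (norm_nonneg _)]
    exact Real.rpow_le_rpow (norm_nonneg _) (norm_mul_le (show A from x) (show A from y)) hp0.le
  eq_zero_of_map_eq_zero' x hx := by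
    exact norm_eq_zero.1 ((Real.rpow_eq_zero (norm_nonneg _) hp0.ne').1 hx)

noncomputable instance (p : ℝ) [hp : Fact (0 < p ∧ p ≤ 1)] (A : Type*) [NormedRing A] :
    NormedRing (PN p A) := RingNorm.toNormedRing (pRingNorm p hp.1.1 hp.1.2 A)

/-- identity -/
def toPN (p : ℝ) (A : Type*) [NormedRing A] : A →+* PN p A := RingHom.id A

/-- identity -/
def ofPN (p : ℝ) (A : Type*) [NormedRing A] : PN p A →+* A := RingHom.id A

lemma norm_PN (p : ℝ) [hp : Fact (0 < p ∧ p ≤ 1)] (A : Type*) [NormedRing A] (x : PN p A) :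
    ‖x‖ = ‖ofPN p A x‖ ^ p := rfl

lemma dist_PN (p : ℝ) [hp : Fact (0 < p ∧ p ≤ 1)] (A : Type*) [NormedRing A] (x y : PN p A) :
    dist x y = dist (ofPN p A x) (ofPN p A y) ^ p := by
  rw [dist_eq_norm, dist_eq_norm, norm_PN, map_sub]

lemma continuous_toPN (p : ℝ) [hp : Fact (0 < p ∧ p ≤ 1)] (A : Type*) [NormedRing A] :
    Continuous (toPN p A) := by
  rw [continuous_iff_continuousAt]
  intro x
  rw [ContinuousAt, tendsto_iff_dist_tendsto_zero]
  have h : Filter.Tendsto (fun y => dist y x ^ p) (nhds x) (nhds (dist x x ^ p)) := by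
    have : Continuous fun y : A => dist y x ^ p :=
      (continuous_id.dist continuous_const).rpow_const fun _ => Or.inr hp.1.1.le
    exact this.tendsto x
  rw [dist_self, Real.zero_rpow hp.1.1.ne'] at h
  refine h.congr fun y => ?_
  rw [dist_PN]
  rfl

lemma lt_of_rpow_PN {p x e : ℝ} (hp : 0 < p) (he : 0 < e) (h : x ^ p < e ^ p) : x < e := by
  by_contra hx
  exact absurd (Real.rpow_le_rpow he.le (not_lt.1 hx) hp.le) (not_le.2 h)

instance completePN (p : ℝ) [hp : Fact (0 < p ∧ p ≤ 1)] (A : Type*) [NormedRing A]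
    [CompleteSpace A] : CompleteSpace (PN p A) := by
  refine Metric.complete_of_cauchySeq_tendsto fun u hu => ?_
  have hu2 : CauchySeq fun n => ofPN p A (u n) := by
    rw [Metric.cauchySeq_iff] at hu ⊢
    intro e he
    obtain ⟨N, hN⟩ := hu (e ^ p) (Real.rpow_pos_of_pos he p)
    refine ⟨N, fun m hm n hn => ?_⟩
    have := hN m hm n hn
    rw [dist_PN] at this
    exact lt_of_rpow_PN hp.1.1 he this
  obtain ⟨a, ha⟩ := cauchySeq_tendsto_of_complete hu2
  exact ⟨toPN p A a, ((continuous_toPN p A).tendsto a).comp ha⟩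

lemma continuous_ofPN (p : ℝ) [hp : Fact (0 < p ∧ p ≤ 1)] (A : Type*) [NormedRing A] :
    Continuous (ofPN p A) := by
  rw [Metric.continuous_iff]
  intro b e he
  refine ⟨e ^ p, Real.rpow_pos_of_pos he p, fun a ha => ?_⟩
  rw [dist_PN] at ha
  exact lt_of_rpow_PN hp.1.1 he ha

/-- The growth condition extracted from admissibility. -/
def GoodW (ω : ℤ → ℝ) : Prop := ∀ r : ℝ, 1 < r → ∀ θ > 0, ∃ n : ℕ, 0 < n ∧
  ω n * (r ^ n)⁻¹ ≤ θ ∧ ω (-(n : ℤ)) * (r ^ n)⁻¹ ≤ θ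

theorem banach_wiener {A : Type*} [NormedRing A] [NormedAlgebra ℂ A] [CompleteSpace A]
    (p : ℝ) (hp0 : 0 < p) (hp1 : p ≤ 1) (ω : ℤ → ℝ) (hω : IsWeight ω) (hg : GoodW ω)
    (a : ℤ → A) (ha : Summable fun n => ‖a n‖ ^ p * ω n ^ p)
    (hinv : ∀ lam : ℂ, ‖lam‖ = 1 → ∀ s, HasSum (fun n => lam ^ n • a n) s → ∃ u, u * s = 1) :
    ∃ b : ℤ → A, (Summable fun n => ‖b n‖ ^ p * ω n ^ p) ∧ ∀ lam : ℂ, ‖lam‖ = 1 → ∀ s t,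
      HasSum (fun n => lam ^ n • a n) s → HasSum (fun n => lam ^ n • b n) t → t * s = 1 := by
  have hF : Fact (0 < p ∧ p ≤ 1) := ⟨⟨hp0, hp1⟩⟩
  have h0 : ∀ n, 0 ≤ ω n := fun n => zero_le_one.trans (hω.1 n)
  obtain ⟨b, hb, hbm⟩ := abs_wiener (fun n => ω n ^ p)
    ⟨fun n => Real.one_le_rpow (hω.1 n) hp0.le, fun m n => by
      rw [← Real.mul_rpow (h0 m) (h0 n)]
      exact Real.rpow_le_rpow (h0 _) (hω.2 m n) hp0.le⟩
    (PN p A) p hp0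
    (by
      intro c x
      rw [norm_PN, norm_PN]
      change ‖c • ofPN p A x‖ ^ p ≤ _
      rw [norm_smul, Real.mul_rpow (norm_nonneg _) (norm_nonneg _)])
    (by
      intro r hr θ hθ
      obtain ⟨n, hn, h1, h2⟩ := hg r hr (θ ^ (1 / p)) (Real.rpow_pos_of_pos hθ _)
      have hr0 : 0 ≤ (r ^ n)⁻¹ := by positivity
      have hfin : ∀ y, 0 ≤ y → y * (r ^ n)⁻¹ ≤ θ ^ (1 / p) → y ^ p * ((r ^ n)⁻¹) ^ p ≤ θ := by
        intro y hy h
        rw [← Real.mul_rpow hy hr0]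
        refine (Real.rpow_le_rpow (mul_nonneg hy hr0) h hp0.le).trans (le_of_eq ?_)
        rw [← Real.rpow_mul hθ.le, one_div_mul_cancel hp0.ne', Real.rpow_one]
      exact ⟨n, hn, hfin _ (h0 _) h1, hfin _ (h0 _) h2⟩)
    (fun n => toPN p A (a n))
    (by
      refine ha.congr fun n => ?_
      rw [mul_comm]
      rfl)
    (by
      intro lam hl s hs
      obtain ⟨u, hu⟩ := hinv lam hl (ofPN p A s) (hs.map (ofPN p A) (continuous_ofPN p A))
      exact ⟨toPN p A u, hu⟩)
  refine ⟨fun n => ofPN p A (b n), ?_, ?_⟩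
  · refine hb.congr fun n => ?_
    rw [mul_comm]
    rfl
  · intro lam hl s t hs ht
    exact hbm lam hl (toPN p A s) (toPN p A t) (hs.map (toPN p A) (continuous_toPN p A))
      (ht.map (toPN p A) (continuous_toPN p A))

end PNs

section Four

lemma summable_norm_of_p {A : Type*} [NormedRing A] (p : ℝ) (hp0 : 0 < p) (hp1 : p ≤ 1)
    (ω : ℤ → ℝ) (hω : IsWeight ω) (b : ℤ → A) (hb : Summable fun n => ‖b n‖ ^ p * ω n ^ p) :
    Summable fun n => ‖b n‖ := by
  have h1 : ∀ n, ‖b n‖ ^ p ≤ ‖b n‖ ^ p * ω n ^ p := fun n =>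
    le_mul_of_one_le_right (Real.rpow_nonneg (norm_nonneg _) _) (Real.one_le_rpow (hω.1 n) hp0.le)
  refine Summable.of_norm_bounded_eventually hb ?_
  have h2 : ∀ᶠ n in Filter.cofinite, ‖b n‖ ^ p * ω n ^ p < 1 :=
    hb.tendsto_cofinite_zero.eventually (gt_mem_nhds one_pos)
  filter_upwards [h2] with n hn
  have h3 : ‖b n‖ ^ p < 1 := (h1 n).trans_lt hn
  have h4 : ‖b n‖ < 1 := lt_of_rpow_PN hp0 one_pos (by rwa [Real.one_rpow])
  rw [norm_norm]
  refine le_trans ?_ (h1 n)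
  rcases (norm_nonneg (b n)).eq_or_lt with h | h
  · rw [← h, Real.zero_rpow hp0.ne']
  · calc ‖b n‖ = ‖b n‖ ^ (1 : ℝ) := (Real.rpow_one _).symm
      _ ≤ _ := Real.rpow_le_rpow_of_exponent_ge h h4.le hp1

lemma circ_int (k : ℤ) : ∫ t in (0 : ℝ)..(2 * Real.pi), Complex.exp ((k : ℂ) * Complex.I * t) =
    if k = 0 then ((2 * Real.pi : ℝ) : ℂ) else 0 := by
  split_ifs with h
  · simp [h]
  · have hc : (k : ℂ) * Complex.I ≠ 0 := mul_ne_zero (by exact_mod_cast h) Complex.I_ne_zero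
    rw [integral_exp_mul_complex hc]
    have : (k : ℂ) * Complex.I * ((2 * Real.pi : ℝ) : ℂ) = k * (2 * Real.pi * Complex.I) := by
      push_cast; ring
    rw [this, Complex.exp_int_mul_two_pi_mul_I]
    simp

lemma fourier_tsum {A : Type*} [NormedRing A] [NormedAlgebra ℂ A] [CompleteSpace A]
    (b : ℤ → A) (hb : Summable fun n => ‖b n‖) :
    ContinuousOn (fun z : ℂ => ∑' n : ℤ, z ^ n • b n) {z : ℂ | ‖z‖ = 1} ∧
    (∀ z : ℂ, ‖z‖ = 1 → Summable fun n : ℤ => z ^ n • b n) ∧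
    ∀ n, fourierCoef (fun z : ℂ => ∑' n : ℤ, z ^ n • b n) n = b n := by
  have hn : ∀ z : ℂ, ‖z‖ = 1 → ∀ n : ℤ, ‖z ^ n • b n‖ = ‖b n‖ := by
    intro z hz n
    rw [norm_smul, norm_zpow, hz, one_zpow, one_mul]
  have hsum : ∀ z : ℂ, ‖z‖ = 1 → Summable fun n : ℤ => z ^ n • b n := fun z hz =>
    Summable.of_norm_bounded hb fun n => (hn z hz n).le
  refine ⟨?_, hsum, ?_⟩
  · refine continuousOn_tsum (fun n => ?_) hb fun n z hz => (hn z hz n).le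
    refine ContinuousOn.smul (fun z hz => ?_) continuousOn_const
    refine (continuousAt_zpow₀ z n (Or.inl ?_)).continuousWithinAt
    intro h
    have : ‖z‖ = 1 := hz
    rw [h, norm_zero] at this
    exact zero_ne_one this
  · intro n
    have he : ∀ t : ℝ, ‖Complex.exp (Complex.I * (t : ℂ))‖ = 1 := by
      intro t
      rw [mul_comm]; exact Complex.norm_exp_ofReal_mul_I t
    have heq : ∀ (t : ℝ) (m : ℤ), Complex.exp (-(n : ℂ) * Complex.I * (t : ℂ)) •
        (Complex.exp (Complex.I * (t : ℂ)) ^ m • b m) =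
        Complex.exp (((m - n : ℤ) : ℂ) * Complex.I * t) • b m := by
      intro t m
      rw [smul_smul, ← Complex.exp_int_mul, ← Complex.exp_add]
      congr 2
      push_cast; ring
    have hne : ∀ (t : ℝ) (k : ℤ), ‖Complex.exp ((k : ℂ) * Complex.I * t)‖ = 1 := by
      intro t k
      have : (k : ℂ) * Complex.I * t = ((k * t : ℝ) : ℂ) * Complex.I := by push_cast; ring
      rw [this]; exact Complex.norm_exp_ofReal_mul_I _
    have h := intervalIntegral.hasSum_integral_of_dominated_convergence (ι := ℤ)
      (μ := MeasureTheory.volume) (a := 0) (b := 2 * Real.pi)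
      (F := fun m (t : ℝ) => Complex.exp (((m - n : ℤ) : ℂ) * Complex.I * t) • b m)
      (f := fun t : ℝ => Complex.exp (-(n : ℂ) * Complex.I * (t : ℂ)) •
        ∑' m : ℤ, Complex.exp (Complex.I * (t : ℂ)) ^ m • b m)
      (fun m _ => ‖b m‖)
      (fun m => (by fun_prop : Continuous fun t : ℝ =>
        Complex.exp (((m - n : ℤ) : ℂ) * Complex.I * t) • b m).aestronglyMeasurable)
      (fun m => Filter.Eventually.of_forall fun t _ => by
        rw [norm_smul, hne, one_mul])
      (Filter.Eventually.of_forall fun t _ => hb)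
      (by simp)
      (Filter.Eventually.of_forall fun t _ => by
        have := (hsum _ (he t)).hasSum.const_smul (Complex.exp (-(n : ℂ) * Complex.I * (t : ℂ)))
        simpa only [heq] using this)
    have h2 : ∀ m : ℤ, ∫ t in (0 : ℝ)..(2 * Real.pi),
        Complex.exp (((m - n : ℤ) : ℂ) * Complex.I * t) • b m =
        if m = n then ((2 * Real.pi : ℝ) : ℂ) • b n else 0 := by
      intro m
      rw [intervalIntegral.integral_smul_const, circ_int]
      by_cases hmn : m = n
      · simp [hmn]
      · simp [hmn, sub_eq_zero]
    simp only [h2] at h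
    have h3 := h.unique (hasSum_ite_eq n (((2 * Real.pi : ℝ) : ℂ) • b n))
    unfold fourierCoef
    rw [h3, smul_smul, inv_mul_cancel₀, one_smul]
    exact_mod_cast (by positivity : (2 * Real.pi : ℝ) ≠ 0)

theorem good_case {A : Type*} [NormedRing A] [NormedAlgebra ℂ A] [CompleteSpace A]
    (p : ℝ) (hp0 : 0 < p) (hp1 : p ≤ 1) (ω : ℤ → ℝ) (hω : IsWeight ω) (hg : GoodW ω)
    (f : ℂ → A) (hf : HasPACFS p ω f)
    (hinv : ∀ z : ℂ, ‖z‖ = 1 → ∃ u : A, u * f z = 1) :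
    ∃ g : ℂ → A, ContinuousOn g {z : ℂ | ‖z‖ = 1} ∧ HasPACFS p ω g ∧
        ∀ z : ℂ, ‖z‖ = 1 → g z * f z = 1 := by
  obtain ⟨b, hb, hbm⟩ := banach_wiener p hp0 hp1 ω hω hg (fourierCoef f) hf.2 (by
    intro lam hl s hs
    rw [hs.unique (hf.1 lam hl)]
    exact hinv lam hl)
  obtain ⟨h1, h2, h3⟩ := fourier_tsum b (summable_norm_of_p p hp0 hp1 ω hω b hb)
  refine ⟨fun z : ℂ => ∑' n : ℤ, z ^ n • b n, h1, ⟨?_, ?_⟩, ?_⟩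
  · intro z hz
    simp only [h3]
    exact (h2 z hz).hasSum
  · simpa only [h3] using hb
  · intro z hz
    exact hbm z hz _ _ (hf.1 z hz) (h2 z hz).hasSum

end Four

section Weights

lemma weight_mul {ω : ℤ → ℝ} (hω : IsWeight ω) (N : ℤ) (k : ℕ) :
    ω (((k + 1 : ℕ) : ℤ) * N) ≤ ω N ^ (k + 1) := by
  induction k with
  | zero => simp
  | succ k ih =>
    have : (((k + 1 + 1 : ℕ) : ℤ)) * N = ((k + 1 : ℕ) : ℤ) * N + N := by push_cast; ring
    rw [this, pow_succ]
    exact (hω.2 _ _).trans (mul_le_mul_of_nonneg_right ih (zero_le_one.trans (hω.1 N)))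

lemma adm_good {ω : ℤ → ℝ} (hω : IsWeight ω) (ha : IsAdmissible ω) : GoodW ω := by
  intro r hr θ hθ
  have h0 : ∀ n, 0 < ω n := fun n => one_pos.trans_le (hω.1 n)
  set s := Real.sqrt r with hs
  have hs1 : 1 < s := by rw [hs]; exact Real.lt_sqrt_of_sq_lt (by simpa using hr)
  have hs0 : 0 < s := by linarith
  have hss : s * s = r := Real.mul_self_sqrt (by linarith)
  obtain ⟨N₂, hN₂, h2⟩ : ∃ n : ℕ, 0 < n ∧ ω n ≤ s ^ n := by
    obtain ⟨x, ⟨n, hn, rfl⟩, hx⟩ := exists_lt_of_csInf_lt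
      (s := {x : ℝ | ∃ n : ℕ, 0 < n ∧ x = ω (n : ℤ) ^ ((1 : ℝ) / (n : ℝ))})
      ⟨_, 1, one_pos, rfl⟩ (show sInf _ < s by have := ha.2; unfold rho2 at this; rwa [this])
    refine ⟨n, hn, ?_⟩
    have := pow_le_pow_left₀ (Real.rpow_nonneg (h0 _).le _) hx.le n
    rwa [one_div, Real.rpow_inv_natCast_pow (h0 _).le hn.ne'] at this
  obtain ⟨N₁, hN₁, h1⟩ : ∃ n : ℕ, 0 < n ∧ ω (-(n : ℤ)) ≤ s ^ n := by
    obtain ⟨x, ⟨n, hn, rfl⟩, hx⟩ := exists_lt_of_lt_csSup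
      (s := {x : ℝ | ∃ n : ℕ, 0 < n ∧ x = ω (-(n : ℤ)) ^ (-(1 : ℝ) / (n : ℝ))})
      ⟨_, 1, one_pos, rfl⟩ (show s⁻¹ < sSup _ by
        have := ha.1; unfold rho1 at this; rw [this]; exact inv_lt_one_of_one_lt₀ hs1)
    refine ⟨n, hn, ?_⟩
    rw [neg_div, one_div, Real.rpow_neg (h0 _).le] at hx
    have hx2 := (inv_lt_inv₀ hs0 (Real.rpow_pos_of_pos (h0 _) _)).1 hx
    have := pow_le_pow_left₀ (Real.rpow_nonneg (h0 _).le _) hx2.le n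
    rwa [Real.rpow_inv_natCast_pow (h0 _).le hn.ne'] at this
  obtain ⟨k, hk⟩ := exists_pow_lt_of_lt_one hθ (inv_lt_one_of_one_lt₀ hs1)
  have hpos : 0 < (k + 1) * N₁ * N₂ := by positivity
  have hge : k ≤ (k + 1) * N₁ * N₂ := by
    have : 1 ≤ N₁ * N₂ := Nat.mul_pos hN₁ hN₂
    nlinarith
  have hfin : ∀ y, y ≤ s ^ ((k + 1) * N₁ * N₂) → y * (r ^ ((k + 1) * N₁ * N₂))⁻¹ ≤ θ := by
    intro y hy
    set n := (k + 1) * N₁ * N₂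
    calc y * (r ^ n)⁻¹ ≤ s ^ n * (r ^ n)⁻¹ := mul_le_mul_of_nonneg_right hy (by positivity)
      _ = s⁻¹ ^ n := by
        rw [← hss, mul_pow, inv_pow]; field_simp
      _ ≤ s⁻¹ ^ k := pow_le_pow_of_le_one (by positivity) (inv_lt_one_of_one_lt₀ hs1).le hge
      _ ≤ θ := hk.le
  have hgen : ∀ (M : ℤ) (N m : ℕ), 0 < m → ω M ≤ s ^ N → ω ((m : ℤ) * M) ≤ s ^ (N * m) := by
    intro M N m hm h
    obtain ⟨j, rfl⟩ := Nat.exists_eq_add_of_lt hm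
    rw [zero_add]
    refine (weight_mul hω M j).trans ?_
    rw [pow_mul]
    exact pow_le_pow_left₀ (h0 _).le h _
  refine ⟨(k + 1) * N₁ * N₂, hpos, hfin _ ?_, hfin _ ?_⟩
  · have := hgen N₂ N₂ ((k + 1) * N₁) (by positivity) h2
    convert this using 2
    · push_cast; ring
    · ring
  · have := hgen (-N₁) N₁ ((k + 1) * N₂) (by positivity) h1
    convert this using 2
    · push_cast; ring
    · ring

lemma lin_weight {ω : ℤ → ℝ} (hω : IsWeight ω) (ε : ℤ) (hε : ε = 1 ∨ ε = -1) (c : ℝ) (hc : 0 < c)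
    (h : ∀ n : ℕ, 0 < n → (1 + c) ^ n ≤ ω (ε * n)) :
    ∃ ν : ℤ → ℝ, IsWeight ν ∧ GoodW ν ∧ (∀ n, 1 ≤ ν n ∧ ν n ≤ ω n) ∧
      (¬ ∃ d, ∀ n, ν n = d) ∧ ¬ ∃ d, ∀ n, ω n = d := by
  have hee : ε * ε = 1 := by rcases hε with h | h <;> rw [h] <;> rfl
  have hle : ∀ n, 1 + c * max ((ε * n : ℤ) : ℝ) 0 ≤ ω n := by
    intro n
    rcases le_or_gt (ε * n) 0 with hn | hn
    · rw [max_eq_right (by exact_mod_cast hn)]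
      simpa using hω.1 n
    · obtain ⟨m, hm⟩ := Int.eq_ofNat_of_zero_le hn.le
      have hm0 : 0 < m := by omega
      have hnm : n = ε * m := by rw [← hm, ← mul_assoc, hee, one_mul]
      have hb := one_add_mul_le_pow (show (-2 : ℝ) ≤ c by linarith) m
      rw [max_eq_left (by exact_mod_cast hn.le), hm, hnm]
      refine le_trans ?_ (h m hm0)
      push_cast
      linarith
  have hval : ∀ m : ℕ, 1 + c * max ((ε * (ε * m) : ℤ) : ℝ) 0 = 1 + c * m := by
    intro m
    rw [← mul_assoc, hee, one_mul]
    simp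
  refine ⟨fun n => 1 + c * max ((ε * n : ℤ) : ℝ) 0, ⟨?_, ?_⟩, ?_, ?_, ?_, ?_⟩
  · intro n
    have := le_max_right ((ε * n : ℤ) : ℝ) 0
    nlinarith
  · intro m n
    have h1 := le_max_right ((ε * n : ℤ) : ℝ) 0
    have h2 := le_max_right ((ε * m : ℤ) : ℝ) 0
    have h3 : max ((ε * (m + n) : ℤ) : ℝ) 0 ≤ max ((ε * m : ℤ) : ℝ) 0 + max ((ε * n : ℤ) : ℝ) 0 := by
      refine max_le ?_ (by linarith)
      have h4 := le_max_left ((ε * n : ℤ) : ℝ) 0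
      have h5 := le_max_left ((ε * m : ℤ) : ℝ) 0
      push_cast at *
      linarith
    have h6 := mul_le_mul_of_nonneg_left h3 hc.le
    have h7 := mul_nonneg (mul_nonneg hc.le h2) (mul_nonneg hc.le h1)
    simp only
    nlinarith
  · intro r hr θ hθ
    have t1 := (tendsto_pow_const_div_const_pow_of_one_lt 1 hr).const_mul c
    have t0 := tendsto_pow_const_div_const_pow_of_one_lt 0 hr
    have t := t0.add t1
    rw [mul_zero, add_zero] at t
    obtain ⟨n, hn1, hn⟩ := ((t.eventually (gt_mem_nhds hθ)).and (Filter.eventually_gt_atTop 0)).exists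
    have hrn : (0 : ℝ) ≤ (r ^ n)⁻¹ := by positivity
    have hfin : ∀ y, y ≤ 1 + c * n → y * (r ^ n)⁻¹ ≤ θ := by
      intro y hy
      refine (mul_le_mul_of_nonneg_right hy hrn).trans (le_trans (le_of_eq ?_) hn1.le)
      rw [pow_zero, pow_one]; ring
    have hmax : ∀ k : ℤ, k = n ∨ k = -n → max ((ε * k : ℤ) : ℝ) 0 ≤ n := by
      intro k hk
      refine max_le ?_ (Nat.cast_nonneg n)
      have : ε * k ≤ n := by
        rcases hε with rfl | rfl <;> rcases hk with rfl | rfl <;> simp <;> omega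
      exact_mod_cast this
    refine ⟨n, hn, hfin _ ?_, hfin _ ?_⟩
    · have := mul_le_mul_of_nonneg_left (hmax n (Or.inl rfl)) hc.le
      simp only
      linarith
    · have := mul_le_mul_of_nonneg_left (hmax (-n) (Or.inr rfl)) hc.le
      simp only
      linarith
  · intro n
    refine ⟨?_, hle n⟩
    have := le_max_right ((ε * n : ℤ) : ℝ) 0
    nlinarith
  · rintro ⟨d, hd⟩
    have h1 := hd (ε * (1 : ℕ))
    have h2 := hd (ε * (2 : ℕ))
    simp only [hval] at h1 h2
    push_cast at h1 h2
    linarith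
  · rintro ⟨d, hd⟩
    obtain ⟨m, hm⟩ := exists_nat_gt (d / c)
    have h1 := hle (ε * m)
    rw [hval, hd] at h1
    rw [div_lt_iff₀ hc] at hm
    linarith

lemma exists_good {ω : ℤ → ℝ} (hω : IsWeight ω) :
    ∃ ν : ℤ → ℝ, IsWeight ν ∧ GoodW ν ∧ (∀ n, 1 ≤ ν n ∧ ν n ≤ ω n) ∧
      ((∃ d, ∀ n, ν n = d) ↔ ∃ d, ∀ n, ω n = d) := by
  have h0 : ∀ n, 0 < ω n := fun n => one_pos.trans_le (hω.1 n)
  by_cases ha : IsAdmissible ω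
  · exact ⟨ω, hω, adm_good hω ha, fun n => ⟨hω.1 n, le_rfl⟩, Iff.rfl⟩
  have hbd2 : BddBelow {x : ℝ | ∃ n : ℕ, 0 < n ∧ x = ω (n : ℤ) ^ ((1 : ℝ) / (n : ℝ))} := by
    refine ⟨0, ?_⟩
    rintro x ⟨n, hn, rfl⟩
    exact Real.rpow_nonneg (h0 _).le _
  have hle1 : ∀ x ∈ {x : ℝ | ∃ n : ℕ, 0 < n ∧ x = ω (-(n : ℤ)) ^ (-(1 : ℝ) / (n : ℝ))}, x ≤ 1 := by
    rintro x ⟨n, hn, rfl⟩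
    refine Real.rpow_le_one_of_one_le_of_nonpos (hω.1 _) ?_
    rw [neg_div]
    have : (0 : ℝ) ≤ 1 / n := by positivity
    linarith
  have hbd1 : BddAbove {x : ℝ | ∃ n : ℕ, 0 < n ∧ x = ω (-(n : ℤ)) ^ (-(1 : ℝ) / (n : ℝ))} :=
    ⟨1, hle1⟩
  have hr1 : rho1 ω ≤ 1 := csSup_le ⟨_, 1, one_pos, rfl⟩ hle1
  have hr2 : 1 ≤ rho2 ω := by
    refine le_csInf ⟨_, 1, one_pos, rfl⟩ ?_
    rintro x ⟨n, hn, rfl⟩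
    exact Real.one_le_rpow (hω.1 _) (by positivity)
  have hr1p : 0 < rho1 ω :=
    (Real.rpow_pos_of_pos (h0 _) _).trans_le (le_csSup hbd1 ⟨1, one_pos, rfl⟩)
  have hcase : rho1 ω < 1 ∨ 1 < rho2 ω := by
    by_contra hcon
    rw [not_or, not_lt, not_lt] at hcon
    exact ha ⟨le_antisymm hr1 hcon.1, le_antisymm hcon.2 hr2⟩
  have hmain : ∃ ν : ℤ → ℝ, IsWeight ν ∧ GoodW ν ∧ (∀ n, 1 ≤ ν n ∧ ν n ≤ ω n) ∧
      (¬ ∃ d, ∀ n, ν n = d) ∧ ¬ ∃ d, ∀ n, ω n = d := by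
    rcases hcase with hlt | hlt
    · have hinv1 : 1 < (rho1 ω)⁻¹ := (one_lt_inv₀ hr1p).2 hlt
      refine lin_weight hω (-1) (Or.inr rfl) ((rho1 ω)⁻¹ - 1) (by linarith) ?_
      intro n hn
      have h1 : ω (-(n : ℤ)) ^ (-(1 : ℝ) / (n : ℝ)) ≤ rho1 ω := le_csSup hbd1 ⟨n, hn, rfl⟩
      rw [neg_div, one_div, Real.rpow_neg (h0 _).le] at h1
      have h2 := (inv_le_comm₀ (Real.rpow_pos_of_pos (h0 _) _) hr1p).1 h1
      have := pow_le_pow_left₀ (by positivity) h2 n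
      rw [Real.rpow_inv_natCast_pow (h0 _).le hn.ne'] at this
      rw [add_sub_cancel, neg_one_mul]
      exact this
    · refine lin_weight hω 1 (Or.inl rfl) (rho2 ω - 1) (by linarith) ?_
      intro n hn
      have h1 : rho2 ω ≤ ω (n : ℤ) ^ ((1 : ℝ) / (n : ℝ)) := csInf_le hbd2 ⟨n, hn, rfl⟩
      rw [one_div] at h1
      have := pow_le_pow_left₀ (by linarith) h1 n
      rw [Real.rpow_inv_natCast_pow (h0 _).le hn.ne'] at this
      rw [add_sub_cancel, one_mul]
      exact this
  obtain ⟨ν, h1, h2, h3, h4, h5⟩ := hmain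
  exact ⟨ν, h1, h2, h3, ⟨fun h => absurd h h4, fun h => absurd h h5⟩⟩

end Weights

/-- **Theorem 1.** Let `0 < p ≤ 1`, `ω` a weight on `ℤ`, `A` a unital Banach algebra, and
`f : 𝕋 → A` continuous with `pω`-ACFS such that `f(z)` is left invertible for all `z ∈ 𝕋`.
Then there are a weight `ν` and a continuous `g : 𝕋 → A` with `1 ≤ ν ≤ ω`, `ν` constant iff
`ω` constant, `g` has `pν`-ACFS and `g` is a left inverse of `f`.  In particular, if `ω` is
admissible then `f` has a left inverse with `pω`-ACFS. -/
theorem stmt0 {A : Type*} [NormedRing A] [NormedAlgebra ℂ A] [CompleteSpace A] [NormOneClass A]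
    (p : ℝ) (hp0 : 0 < p) (hp1 : p ≤ 1)
    (ω : ℤ → ℝ) (hω : IsWeight ω)
    (f : ℂ → A) (hfc : ContinuousOn f {z : ℂ | ‖z‖ = 1})
    (hf : HasPACFS p ω f)
    (hinv : ∀ z : ℂ, ‖z‖ = 1 → ∃ u : A, u * f z = 1) :
    (∃ (ν : ℤ → ℝ) (g : ℂ → A), IsWeight ν ∧
        (∀ n, 1 ≤ ν n ∧ ν n ≤ ω n) ∧
        ((∃ c, ∀ n, ν n = c) ↔ (∃ c, ∀ n, ω n = c)) ∧
        ContinuousOn g {z : ℂ | ‖z‖ = 1} ∧ HasPACFS p ν g ∧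
        ∀ z : ℂ, ‖z‖ = 1 → g z * f z = 1) ∧
      (IsAdmissible ω → ∃ g : ℂ → A,
        ContinuousOn g {z : ℂ | ‖z‖ = 1} ∧ HasPACFS p ω g ∧
        ∀ z : ℂ, ‖z‖ = 1 → g z * f z = 1) := by
  refine ⟨?_, fun ha => good_case p hp0 hp1 ω hω (adm_good hω ha) f hf hinv⟩
  obtain ⟨ν, h1, h2, h3, h4⟩ := exists_good hω
  have hfν : HasPACFS p ν f := by
    refine ⟨hf.1, Summable.of_nonneg_of_le (fun n => ?_) (fun n => ?_) hf.2⟩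
    · exact mul_nonneg (Real.rpow_nonneg (norm_nonneg _) _)
        (Real.rpow_nonneg (zero_le_one.trans (h3 n).1) _)
    · exact mul_le_mul_of_nonneg_left
        (Real.rpow_le_rpow (zero_le_one.trans (h3 n).1) (h3 n).2 hp0.le)
        (Real.rpow_nonneg (norm_nonneg _) _)
  obtain ⟨g, hg1, hg2, hg3⟩ := good_case p hp0 hp1 ν h1 h2 f hfν hinv
  exact ⟨ν, g, h1, h3, h4, hg1, hg2, hg3⟩
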